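/- On the Sierpinski gasket graph, for every ε > 0 there is n_ε such that for all n ≥ n_ε and all z ∈ B_o(n(1−ε)): Σ_{y ∈ B_o(n)} g_n(y,z) ≤ |B_o(n)| · g_n(o,z), where g_n is the Green function stopped on exiting B_o(n). -/

import Mathlib

open Finset

attribute [local instance] Classical.propDecidable

namespace IDLA

variable {V : Type*}

/-- The weight (probability) of a given path of the simple random walk. -/
noncomputable def pathWeight (G : SimpleGraph V) [G.LocallyFinite] {n : ℕ}
    (p : Fin (n + 1) → V) : ℝ :=
  ∏ i : Fin n, ((G.degree (p i.castSucc) : ℝ))⁻¹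

/-- A path is a nearest-neighbor walk staying inside `B`. -/
def IsWalkIn (G : SimpleGraph V) (B : Set V) {n : ℕ} (p : Fin (n + 1) → V) : Prop :=
  (∀ i : Fin n, G.Adj (p i.castSucc) (p i.succ)) ∧ ∀ i, p i ∈ B

/-- Stopped Green function `g_B(y,x)`: expected number of visits to `x` of the simple
random walk started at `y`, before exiting `B`. -/
noncomputable def green (G : SimpleGraph V) [G.LocallyFinite] (B : Set V) (y x : V) : ℝ :=
  ∑' n : ℕ, ∑' p : Fin (n + 1) → V,
    if IsWalkIn G B p ∧ p 0 = y ∧ p (Fin.last n) = x then pathWeight G p else 0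

/-- `P_y[τ_x < τ_B]`: probability that the walk started at `y` hits `x` before exiting `B`. -/
noncomputable def hitProb (G : SimpleGraph V) [G.LocallyFinite] (B : Set V) (y x : V) : ℝ :=
  ∑' n : ℕ, ∑' p : Fin (n + 1) → V,
    if IsWalkIn G B p ∧ p 0 = y ∧ p (Fin.last n) = x ∧ (∀ i : Fin n, p i.castSucc ≠ x)
    then pathWeight G p else 0

/-- `P_y[σ_A < τ_B]`: probability that the walk started at `y` hits the set `A`
before exiting `B`. -/
noncomputable def hitSetProb (G : SimpleGraph V) [G.LocallyFinite] (B A : Set V) (y : V) : ℝ :=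
  ∑' n : ℕ, ∑' p : Fin (n + 1) → V,
    if IsWalkIn G B p ∧ p 0 = y ∧ p (Fin.last n) ∈ A ∧ (∀ i : Fin n, p i.castSucc ∉ A)
    then pathWeight G p else 0

/-- Expected exit time `E_y[τ_B] = ∑_{n ≥ 0} P_y[τ_B > n]`. -/
noncomputable def expectedExitTime (G : SimpleGraph V) [G.LocallyFinite] (B : Set V) (y : V) : ℝ :=
  ∑' n : ℕ, ∑' p : Fin (n + 1) → V,
    if IsWalkIn G B p ∧ p 0 = y then pathWeight G p else 0

/-- Open ball of real radius `r` about `o` in the graph metric. -/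
def ball (G : SimpleGraph V) (o : V) (r : ℝ) : Set V := {y | (G.dist o y : ℝ) < r}

/-- Probabilistic graph Laplacian. -/
noncomputable def lap (G : SimpleGraph V) [G.LocallyFinite] (h : V → ℝ) (z : V) : ℝ :=
  (∑ y ∈ G.neighborFinset z, h y) / (G.degree z) - h z

noncomputable section

/-- Translate a set of points in the plane. -/
def trSet (a : ℝ × ℝ) (S : Set (ℝ × ℝ)) : Set (ℝ × ℝ) := (fun p => a + p) '' S

/-- Vertices of the level-`n` Sierpinski gasket graph. -/
def gasketV : ℕ → Set (ℝ × ℝ)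
  | 0 => {(0, 0), (1, 0), (1 / 2, Real.sqrt 3 / 2)}
  | n + 1 =>
      gasketV n ∪ trSet ((2 : ℝ) ^ n, 0) (gasketV n) ∪
        trSet ((2 : ℝ) ^ n / 2, (2 : ℝ) ^ n / 2 * Real.sqrt 3) (gasketV n)

/-- Edges of the level-`n` Sierpinski gasket graph. -/
def gasketE : ℕ → Set ((ℝ × ℝ) × (ℝ × ℝ))
  | 0 => {((0, 0), (1, 0)), ((0, 0), (1 / 2, Real.sqrt 3 / 2)),
      ((1, 0), (1 / 2, Real.sqrt 3 / 2))}
  | n + 1 =>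
      gasketE n ∪
        (fun e => (((2 : ℝ) ^ n, 0) + e.1, ((2 : ℝ) ^ n, 0) + e.2)) '' gasketE n ∪
        (fun e => (((2 : ℝ) ^ n / 2, (2 : ℝ) ^ n / 2 * Real.sqrt 3) + e.1,
          ((2 : ℝ) ^ n / 2, (2 : ℝ) ^ n / 2 * Real.sqrt 3) + e.2)) '' gasketE n

/-- Vertex set of the doubly infinite Sierpinski gasket graph. -/
def SGV : Set (ℝ × ℝ) := (⋃ n, gasketV n) ∪ (-(⋃ n, gasketV n))

/-- Edge set of the doubly infinite Sierpinski gasket graph. -/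
def SGE : Set ((ℝ × ℝ) × (ℝ × ℝ)) :=
  (⋃ n, gasketE n) ∪ ((fun e => (-e.1, -e.2)) '' ⋃ n, gasketE n)

/-- The doubly infinite Sierpinski gasket graph `SG`. -/
def SGGraph : SimpleGraph SGV :=
  SimpleGraph.fromRel fun x y => ((x : ℝ × ℝ), (y : ℝ × ℝ)) ∈ SGE

/-- The origin `o = (0,0)` of `SG`. -/
def oSG : SGV :=
  ⟨(0, 0), Or.inl (Set.mem_iUnion.mpr ⟨0, by simp [gasketV]⟩)⟩

end

/-! ### The Green function of a finite set -/

section Green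

variable {V : Type*}

/-- `N`-step transition weights of the walk killed outside `B`. -/
noncomputable def pw (G : SimpleGraph V) [G.LocallyFinite] (B : Set V) : ℕ → V → V → ℝ
  | 0, y, x => if y ∈ B ∧ y = x then 1 else 0
  | N + 1, y, x => if y ∈ B then
      ∑ y' ∈ G.neighborFinset y, ((G.degree y : ℝ))⁻¹ * pw G B N y' x else 0

lemma pw_nonneg (G : SimpleGraph V) [G.LocallyFinite] (B : Set V) (N : ℕ) (y x : V) :
    0 ≤ pw G B N y x := by
  induction N generalizing y with
  | zero => unfold pw; split_ifs <;> norm_num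
  | succ N ih =>
    unfold pw; split_ifs
    · exact Finset.sum_nonneg fun y' _ => mul_nonneg (by positivity) (ih y')
    · exact le_rfl

lemma pw_out (G : SimpleGraph V) [G.LocallyFinite] (B : Set V) (N : ℕ) (y x : V) (hy : y ∉ B) :
    pw G B N y x = 0 := by
  cases N <;> simp [pw, hy]

lemma isWalkIn_cons (G : SimpleGraph V) (B : Set V) {n : ℕ} (a : V) (q : Fin (n + 1) → V) :
    IsWalkIn G B (n := n + 1) (Fin.cons a q : Fin (n + 2) → V) ↔
      a ∈ B ∧ G.Adj a (q 0) ∧ IsWalkIn G B q := by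
  unfold IsWalkIn
  constructor
  · rintro ⟨h1, h2⟩
    refine ⟨by simpa using h2 0, by simpa using h1 0, fun i => ?_, fun i => by simpa using h2 i.succ⟩
    have := h1 i.succ
    rw [← Fin.succ_castSucc] at this
    simpa using this
  · rintro ⟨h1, h2, h3, h4⟩
    refine ⟨fun i => ?_, fun i => ?_⟩
    · refine Fin.cases ?_ (fun i => ?_) i
      · simpa using h2
      · rw [← Fin.succ_castSucc]
        simpa using h3 i
    · refine Fin.cases ?_ (fun i => ?_) i
      · simpa using h1
      · simpa using h4 i

lemma pathWeight_cons (G : SimpleGraph V) [G.LocallyFinite] {n : ℕ} (a : V)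
    (q : Fin (n + 1) → V) :
    pathWeight G (n := n + 1) (Fin.cons a q : Fin (n + 2) → V) =
      ((G.degree a : ℝ))⁻¹ * pathWeight G q := by
  unfold pathWeight
  rw [Fin.prod_univ_succ]
  congr 1
  
lemma hasSum_pw (G : SimpleGraph V) [G.LocallyFinite] (B : Set V) (N : ℕ) (y x : V) :
    HasSum (fun p : Fin (N + 1) → V =>
      if IsWalkIn G B p ∧ p 0 = y ∧ p (Fin.last N) = x then pathWeight G p else 0)
      (pw G B N y x) := by
  induction N generalizing y with
  | zero =>
    have h := hasSum_single (f := fun p : Fin (0 + 1) → V =>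
      if IsWalkIn G B p ∧ p 0 = y ∧ p (Fin.last 0) = x then pathWeight G p else 0)
      (fun _ => y) (by
        intro p hp
        rw [if_neg]
        rintro ⟨_, h0, _⟩
        apply hp
        funext i
        rw [show i = 0 from Fin.fin_one_eq_zero i, h0])
    convert h using 1
    simp [pw, IsWalkIn, pathWeight]
  | succ N ih =>
    have hinj : Function.Injective (fun q : Fin (N + 1) → V => (Fin.cons y q : Fin (N + 2) → V)) :=
      fun q q' h => (Fin.cons_injective2 h).2
    rw [← hinj.hasSum_iff]
    · by_cases hy : y ∈ B
      · have h2 := hasSum_sum (s := G.neighborFinset y)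
          (fun y' _ => (ih y').mul_left ((G.degree y : ℝ))⁻¹)
        rw [pw, if_pos hy]
        convert h2 using 1
        · rfl
        funext q
        simp only [Function.comp]
        rw [isWalkIn_cons, pathWeight_cons]
        by_cases hq : IsWalkIn G B q ∧ q (Fin.last N) = x
        · by_cases ha : G.Adj y (q 0)
          · rw [if_pos ⟨⟨hy, ha, hq.1⟩, by simp, by rw [← Fin.succ_last]; simpa using hq.2⟩]
            rw [Finset.sum_eq_single (q 0)]
            · rw [if_pos ⟨hq.1, rfl, hq.2⟩]
            · intro b _ hb
              rw [if_neg (fun h => hb h.2.1.symm), mul_zero]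
            · intro h; exact absurd (by simpa using ha) h
          · rw [if_neg (fun h => ha h.1.2.1)]
            symm
            apply Finset.sum_eq_zero
            intro b hb
            rw [if_neg, mul_zero]
            rintro ⟨_, h, _⟩
            apply ha
            rw [h]; simpa using hb
        · rw [if_neg]
          · symm
            apply Finset.sum_eq_zero
            intro b hb
            rw [if_neg, mul_zero]
            rintro ⟨h1, _, h2⟩
            exact hq ⟨h1, h2⟩
          · rintro ⟨h1, _, h2⟩
            rw [← Fin.succ_last] at h2
            exact hq ⟨h1.2.2, by simpa using h2⟩
      · rw [pw, if_neg hy]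
        convert hasSum_zero using 1
        funext q
        simp only [Function.comp]
        rw [isWalkIn_cons, if_neg (fun h => hy h.1.1)]
    · intro p hp
      rw [if_neg]
      rintro ⟨_, h0, _⟩
      apply hp
      refine ⟨Fin.tail p, ?_⟩
      simp only
      rw [← h0, Fin.cons_self_tail]

lemma green_eq (G : SimpleGraph V) [G.LocallyFinite] (B : Set V) (y x : V) :
    green G B y x = ∑' N, pw G B N y x := by
  unfold green
  congr 1
  funext N
  exact (hasSum_pw G B N y x).tsum_eq

/-- Pairing of a function with the transition weights. -/
noncomputable def pair (G : SimpleGraph V) [G.LocallyFinite] (B : Finset V) (z : V)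
    (f : V → ℝ) (N : ℕ) : ℝ := ∑ y ∈ B, f y * pw G (B : Set V) N y z

/-- One step of the killed walk. -/
noncomputable def stepOp (G : SimpleGraph V) [G.LocallyFinite] (B : Finset V)
    (f : V → ℝ) (y : V) : ℝ := (4 : ℝ)⁻¹ * ∑ x ∈ G.neighborFinset y, if x ∈ B then f x else 0

lemma pair_succ (G : SimpleGraph V) [G.LocallyFinite] (hdeg : ∀ v, G.degree v = 4)
    (B : Finset V) (z : V) (f : V → ℝ) (N : ℕ) :
    pair G B z f (N + 1) = pair G B z (stepOp G B f) N := by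
  unfold pair stepOp
  have h1 : ∀ y ∈ B, f y * pw G (B : Set V) (N + 1) y z =
      ∑ x ∈ B, if G.Adj y x then (4 : ℝ)⁻¹ * f y * pw G (B : Set V) N x z else 0 := by
    intro y hy
    rw [pw, if_pos (by simpa using hy), hdeg, Finset.mul_sum]
    rw [← Finset.sum_filter]
    symm
    apply Finset.sum_subset_zero_on_sdiff
    · intro x hx
      simpa using (Finset.mem_filter.1 hx).2
    · intro x hx
      rw [Finset.mem_sdiff, Finset.mem_filter] at hx
      have : x ∉ B := fun h => hx.2 ⟨h, by simpa using hx.1⟩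
      rw [pw_out _ _ _ _ _ (by simpa using this)]
      ring
    · intro x hx
      push_cast; ring
  have h2 : ∀ x ∈ B, (4 : ℝ)⁻¹ * (∑ y ∈ G.neighborFinset x, if y ∈ B then f y else 0) *
      pw G (B : Set V) N x z =
      ∑ y ∈ B, if G.Adj y x then (4 : ℝ)⁻¹ * f y * pw G (B : Set V) N x z else 0 := by
    intro x hx
    rw [Finset.mul_sum, Finset.sum_mul, ← Finset.sum_filter]
    symm
    apply Finset.sum_subset_zero_on_sdiff
    · intro y hy
      simpa using (Finset.mem_filter.1 hy).2.symm
    · intro y hy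
      rw [Finset.mem_sdiff, Finset.mem_filter] at hy
      have : y ∉ B := fun h => hy.2 ⟨h, (show G.Adj x y by simpa using hy.1).symm⟩
      rw [if_neg this]; ring
    · intro y hy
      rw [if_pos (Finset.mem_filter.1 hy).1]
  rw [Finset.sum_congr rfl h1, Finset.sum_congr rfl h2, Finset.sum_comm]

lemma pair_zero (G : SimpleGraph V) [G.LocallyFinite]
    (B : Finset V) (z : V) (hz : z ∈ B) (f : V → ℝ) : pair G B z f 0 = f z := by
  unfold pair
  rw [Finset.sum_eq_single z]
  · simp [pw, hz]
  · intro b _ hb; simp [pw, hb]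
  · intro h; exact absurd hz h

lemma pair_telescope (G : SimpleGraph V) [G.LocallyFinite] (hdeg : ∀ v, G.degree v = 4)
    (B : Finset V) (z : V) (hz : z ∈ B) (f : V → ℝ) (M : ℕ) :
    ∑ N ∈ Finset.range M, pair G B z (fun y => f y - stepOp G B f y) N =
      f z - pair G B z f M := by
  have h : ∀ N, pair G B z (fun y => f y - stepOp G B f y) N =
      pair G B z f N - pair G B z f (N + 1) := by
    intro N
    rw [pair_succ G hdeg]
    unfold pair
    rw [← Finset.sum_sub_distrib]
    exact Finset.sum_congr rfl fun y _ => by ring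
  simp_rw [h]
  rw [Finset.sum_range_sub', pair_zero G B z hz]

/-- Summability of the Green series in the presence of a Lyapunov function. -/
lemma green_summable (G : SimpleGraph V) [G.LocallyFinite] (hdeg : ∀ v, G.degree v = 4)
    (B : Finset V) (z : V) (hz : z ∈ B) (F : V → ℝ) (hF : ∀ y ∈ B, 0 ≤ F y)
    (hF1 : ∀ y ∈ B, 1 ≤ F y - stepOp G B F y) :
    (∀ y ∈ B, Summable fun N => pw G (B : Set V) N y z) ∧
      ∑ y ∈ B, green G (B : Set V) y z ≤ F z := by
  have hb : ∀ M, ∑ N ∈ Finset.range M, pair G B z (fun _ => 1) N ≤ F z := by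
    intro M
    have h1 : ∑ N ∈ Finset.range M, pair G B z (fun _ => 1) N ≤
        ∑ N ∈ Finset.range M, pair G B z (fun y => F y - stepOp G B F y) N :=
      Finset.sum_le_sum fun N _ => Finset.sum_le_sum fun y hy =>
        mul_le_mul_of_nonneg_right (hF1 y hy) (pw_nonneg _ _ _ _ _)
    rw [pair_telescope G hdeg B z hz] at h1
    have h2 : 0 ≤ pair G B z F M :=
      Finset.sum_nonneg fun y hy => mul_nonneg (hF y hy) (pw_nonneg _ _ _ _ _)
    linarith
  have hnn : ∀ N, 0 ≤ pair G B z (fun _ => 1) N := fun N =>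
    Finset.sum_nonneg fun y hy => mul_nonneg zero_le_one (pw_nonneg _ _ _ _ _)
  have hs : Summable (pair G B z (fun _ => 1)) :=
    summable_of_sum_range_le hnn hb
  have hsy : ∀ y ∈ B, Summable fun N => pw G (B : Set V) N y z := by
    intro y hy
    refine Summable.of_nonneg_of_le (fun N => pw_nonneg _ _ _ _ _) (fun N => ?_) hs
    have := Finset.single_le_sum (f := fun y => (1 : ℝ) * pw G (B : Set V) N y z)
      (fun y _ => mul_nonneg zero_le_one (pw_nonneg _ _ _ _ _)) hy
    simpa [pair] using this
  refine ⟨hsy, ?_⟩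
  simp_rw [green_eq]
  rw [← Summable.tsum_finsetSum hsy]
  have : (fun N => ∑ y ∈ B, pw G (B : Set V) N y z) = pair G B z (fun _ => 1) := by
    funext N; simp [pair]
  rw [this]
  exact hs.tsum_le_of_sum_range_le hb

lemma green_repr (G : SimpleGraph V) [G.LocallyFinite] (hdeg : ∀ v, G.degree v = 4)
    (B : Finset V) (z : V) (hz : z ∈ B) 
    (hs : ∀ y ∈ B, Summable fun N => pw G (B : Set V) N y z) (w : V → ℝ) :
    w z = ∑ y ∈ B, (w y - stepOp G B w y) * green G (B : Set V) y z := by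
  have h1 : HasSum (pair G B z (fun y => w y - stepOp G B w y))
      (∑ y ∈ B, (w y - stepOp G B w y) * green G (B : Set V) y z) := by
    apply hasSum_sum
    intro y hy
    rw [green_eq]
    exact (hs y hy).hasSum.mul_left _
  have h2 := h1.tendsto_sum_nat
  simp_rw [pair_telescope G hdeg B z hz] at h2
  have h3 : Filter.Tendsto (fun M => pair G B z w M) Filter.atTop (nhds 0) := by
    have : Filter.Tendsto (fun M => ∑ y ∈ B, w y * pw G (B : Set V) M y z) Filter.atTop
        (nhds (∑ y ∈ B, w y * 0)) :=
      tendsto_finsetSum _ fun y hy => (hs y hy).tendsto_atTop_zero.const_mul _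
    simpa [pair] using this
  have h4 := h3.const_sub (w z)
  rw [sub_zero] at h4
  exact tendsto_nhds_unique h4 h2

end Green

/-! ### Combinatorial model of the gasket: bottoms of elementary triangles -/

section Model

/-- `T K a b`: the elementary triangle with bottom corner `(a,b)` belongs to the
level-`K` gasket. -/
def T : ℕ → ℤ → ℤ → Prop
  | 0, a, b => a = 0 ∧ b = 0
  | K + 1, a, b => T K a b ∨ T K (a - 2 ^ K) b ∨ T K a (b - 2 ^ K)

lemma T_region {K : ℕ} {a b : ℤ} (h : T K a b) : 0 ≤ a ∧ 0 ≤ b ∧ a + b < 2 ^ K := by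
  induction K generalizing a b with
  | zero => obtain ⟨rfl, rfl⟩ := h; norm_num
  | succ K ih =>
    have h2 : (2 : ℤ) ^ (K + 1) = 2 * 2 ^ K := by ring
    have h3 : (0 : ℤ) < 2 ^ K := by positivity
    rcases h with h | h | h <;> have := ih h <;> omega

noncomputable def chi (K : ℕ) (a b : ℤ) : ℝ := if T K a b then 1 else 0

lemma chi_succ (K : ℕ) (a b : ℤ) :
    chi (K + 1) a b = chi K a b + chi K (a - 2 ^ K) b + chi K a (b - 2 ^ K) := by
  have h3 : (0 : ℤ) < 2 ^ K := by positivity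
  unfold chi
  by_cases h1 : T K a b
  · have r1 := T_region h1
    have n2 : ¬ T K (a - 2 ^ K) b := fun h => by have := T_region h; omega
    have n3 : ¬ T K a (b - 2 ^ K) := fun h => by have := T_region h; omega
    simp [T, h1, n2, n3]
  · by_cases h2 : T K (a - 2 ^ K) b
    · have r1 := T_region h2
      have n3 : ¬ T K a (b - 2 ^ K) := fun h => by have := T_region h; omega
      simp [T, h1, h2, n3]
    · simp [T, h1, h2]

lemma chi_ne {K : ℕ} {a b : ℤ} (h : chi K a b ≠ 0) : T K a b := by
  unfold chi at h
  by_contra h'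
  simp [h'] at h

lemma chi_zero {K : ℕ} {a b : ℤ} (h : ¬ (0 ≤ a ∧ 0 ≤ b ∧ a + b < 2 ^ K)) : chi K a b = 0 := by
  by_contra h'
  exact h (T_region (chi_ne h'))

/-- Number of triangles of level `K` at a vertex. -/
noncomputable def Mm (K : ℕ) (a b : ℤ) : ℝ := chi K a b + chi K (a - 1) b + chi K a (b - 1)

/-- Unnormalized Laplacian on the level-`K` gasket. -/
noncomputable def Lam (K : ℕ) (h : ℤ → ℤ → ℝ) (a b : ℤ) : ℝ :=
  chi K a b * (h (a + 1) b + h a (b + 1) - 2 * h a b) +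
  chi K (a - 1) b * (h (a - 1) b + h (a - 1) (b + 1) - 2 * h a b) +
  chi K a (b - 1) * (h a (b - 1) + h (a + 1) (b - 1) - 2 * h a b)

lemma Mm_succ (K : ℕ) (a b : ℤ) :
    Mm (K + 1) a b = Mm K a b + Mm K (a - 2 ^ K) b + Mm K a (b - 2 ^ K) := by
  unfold Mm
  rw [chi_succ, chi_succ, chi_succ, show a - 1 - 2 ^ K = a - 2 ^ K - 1 by ring,
    show b - 1 - 2 ^ K = b - 2 ^ K - 1 by ring]
  ring

lemma Lam_succ (K : ℕ) (h : ℤ → ℤ → ℝ) (a b : ℤ) :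
    Lam (K + 1) h a b = Lam K h a b + Lam K (fun x y => h (x + 2 ^ K) y) (a - 2 ^ K) b +
      Lam K (fun x y => h x (y + 2 ^ K)) a (b - 2 ^ K) := by
  unfold Lam
  rw [chi_succ, chi_succ, chi_succ, show a - 1 - 2 ^ K = a - 2 ^ K - 1 by ring,
    show b - 1 - 2 ^ K = b - 2 ^ K - 1 by ring]
  simp only [show a - 2 ^ K + 1 + 2 ^ K = a + 1 by ring, show a - 2 ^ K + 2 ^ K = a by ring,
    show a - 2 ^ K - 1 + 2 ^ K = a - 1 by ring, show b - 2 ^ K + 1 + 2 ^ K = b + 1 by ring,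
    show b - 2 ^ K + 2 ^ K = b by ring, show b - 2 ^ K - 1 + 2 ^ K = b - 1 by ring]
  ring

lemma Lam_congr (K : ℕ) (h g : ℤ → ℤ → ℝ)
    (hg : ∀ x y : ℤ, 0 ≤ x → 0 ≤ y → x + y ≤ 2 ^ K → h x y = g x y) (a b : ℤ) :
    Lam K h a b = Lam K g a b := by
  unfold Lam
  congr 1
  · congr 1
    · by_cases hT : T K a b
      · have r := T_region hT
        rw [hg (a + 1) b (by omega) (by omega) (by omega),
          hg a (b + 1) (by omega) (by omega) (by omega), hg a b (by omega) (by omega) (by omega)]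
      · simp [chi, hT]
    · by_cases hT : T K (a - 1) b
      · have r := T_region hT
        rw [hg (a - 1) b (by omega) (by omega) (by omega),
          hg (a - 1) (b + 1) (by omega) (by omega) (by omega),
          hg a b (by omega) (by omega) (by omega)]
      · simp [chi, hT]
  · by_cases hT : T K a (b - 1)
    · have r := T_region hT
      rw [hg a (b - 1) (by omega) (by omega) (by omega),
        hg (a + 1) (b - 1) (by omega) (by omega) (by omega),
        hg a b (by omega) (by omega) (by omega)]
    · simp [chi, hT]

lemma Lam_out {K : ℕ} {h : ℤ → ℤ → ℝ} {a b : ℤ} (hr : ¬ (0 ≤ a ∧ 0 ≤ b ∧ a + b ≤ 2 ^ K)) :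
    Lam K h a b = 0 := by
  unfold Lam
  rw [chi_zero (by omega), chi_zero (by omega), chi_zero (by omega)]
  ring

lemma Mm_out {K : ℕ} {a b : ℤ} (hr : ¬ (0 ≤ a ∧ 0 ≤ b ∧ a + b ≤ 2 ^ K)) :
    Mm K a b = 0 := by
  unfold Mm
  rw [chi_zero (by omega), chi_zero (by omega), chi_zero (by omega)]
  ring

/-- Kronecker delta. -/
noncomputable def dl (a b c d : ℤ) : ℝ := if a = c ∧ b = d then 1 else 0

/-- Function on the level-`K` block with prescribed corner values and constant
Laplacian `s` inside. -/
noncomputable def H (s : ℝ) : ℕ → ℝ → ℝ → ℝ → ℤ → ℤ → ℝ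
  | 0, A, B, C, a, b => if 1 ≤ a then B else if 1 ≤ b then C else A
  | K + 1, A, B, C, a, b =>
    if 2 ^ K ≤ a then
      H s K ((2 * A + 2 * B + C) / 5 - 2 * 5 ^ K * s) B
        ((A + 2 * B + 2 * C) / 5 - 2 * 5 ^ K * s) (a - 2 ^ K) b
    else if 2 ^ K ≤ b then
      H s K ((2 * A + B + 2 * C) / 5 - 2 * 5 ^ K * s)
        ((A + 2 * B + 2 * C) / 5 - 2 * 5 ^ K * s) C a (b - 2 ^ K)
    else H s K A ((2 * A + 2 * B + C) / 5 - 2 * 5 ^ K * s)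
      ((2 * A + B + 2 * C) / 5 - 2 * 5 ^ K * s) a b

lemma H_corners (s : ℝ) (K : ℕ) (A B C : ℝ) :
    H s K A B C 0 0 = A ∧ H s K A B C (2 ^ K) 0 = B ∧ H s K A B C 0 (2 ^ K) = C := by
  induction K generalizing A B C with
  | zero => simp [H]
  | succ K ih =>
    have h2 : (2 : ℤ) ^ (K + 1) = 2 * 2 ^ K := by ring
    have h3 : (0 : ℤ) < 2 ^ K := by positivity
    have h4 : (2 : ℤ) * 2 ^ K - 2 ^ K = 2 ^ K := by ring
    have e1 : ¬ ((2 : ℤ) ^ K ≤ 0) := by omega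
    have e2 : (2 : ℤ) ^ K ≤ 2 * 2 ^ K := by omega
    refine ⟨?_, ?_, ?_⟩
    · rw [H, if_neg e1, if_neg e1]; exact (ih _ _ _).1
    · rw [H, h2, if_pos e2, h4]; exact (ih _ _ _).2.1
    · rw [H, h2, if_neg e1, if_pos e2, h4]; exact (ih _ _ _).2.2

lemma Lam_H (s : ℝ) (K : ℕ) (A B C : ℝ) (a b : ℤ) :
    Lam K (H s K A B C) a b = 2 * s * Mm K a b +
      ((3 / 5) ^ K * (B + C - 2 * A) - 2 * 3 ^ K * s) * dl a b 0 0 +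
      ((3 / 5) ^ K * (A + C - 2 * B) - 2 * 3 ^ K * s) * dl a b (2 ^ K) 0 +
      ((3 / 5) ^ K * (A + B - 2 * C) - 2 * 3 ^ K * s) * dl a b 0 (2 ^ K) := by
  induction K generalizing A B C a b with
  | zero =>
    by_cases h0 : a = 0 ∧ b = 0
    · obtain ⟨rfl, rfl⟩ := h0
      simp [Lam, Mm, chi, T, H, dl]
    · by_cases h1 : a = 1 ∧ b = 0
      · obtain ⟨rfl, rfl⟩ := h1
        simp [Lam, Mm, chi, T, H, dl]
      · by_cases h2 : a = 0 ∧ b = 1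
        · obtain ⟨rfl, rfl⟩ := h2
          simp [Lam, Mm, chi, T, H, dl]
        · have e1 : ¬ (a - 1 = 0 ∧ b = 0) := by omega
          have e2 : ¬ (a = 0 ∧ b - 1 = 0) := by omega
          simp [Lam, Mm, chi, T, dl, h0, h1, h2, e1, e2]
  | succ K ih =>
    have h2 : (2 : ℤ) ^ (K + 1) = 2 * 2 ^ K := by ring
    have h3 : (0 : ℤ) < 2 ^ K := by positivity
    set p := (2 * A + 2 * B + C) / 5 - 2 * 5 ^ K * s with hp
    set q := (A + 2 * B + 2 * C) / 5 - 2 * 5 ^ K * s with hq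
    set r := (2 * A + B + 2 * C) / 5 - 2 * 5 ^ K * s with hr
    rw [Lam_succ]
    rw [Lam_congr K (H s (K + 1) A B C) (H s K A p r)]
    rw [Lam_congr K (fun x y => H s (K + 1) A B C (x + 2 ^ K) y) (H s K p B q)]
    rw [Lam_congr K (fun x y => H s (K + 1) A B C x (y + 2 ^ K)) (H s K r q C)]
    · rw [ih, ih, ih, Mm_succ]
      have d1 : dl (a - 2 ^ K) b 0 0 = dl a b (2 ^ K) 0 := by
        unfold dl; congr 1; apply propext; constructor <;> omega
      have d2 : dl (a - 2 ^ K) b (2 ^ K) 0 = dl a b (2 ^ (K + 1)) 0 := by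
        unfold dl; congr 1; apply propext; constructor <;> omega
      have d3 : dl (a - 2 ^ K) b 0 (2 ^ K) = dl a b (2 ^ K) (2 ^ K) := by
        unfold dl; congr 1; apply propext; constructor <;> omega
      have d4 : dl a (b - 2 ^ K) 0 0 = dl a b 0 (2 ^ K) := by
        unfold dl; congr 1; apply propext; constructor <;> omega
      have d5 : dl a (b - 2 ^ K) (2 ^ K) 0 = dl a b (2 ^ K) (2 ^ K) := by
        unfold dl; congr 1; apply propext; constructor <;> omega
      have d6 : dl a (b - 2 ^ K) 0 (2 ^ K) = dl a b 0 (2 ^ (K + 1)) := by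
        unfold dl; congr 1; apply propext; constructor <;> omega
      rw [d1, d2, d3, d4, d5, d6]
      have e1 : (3 : ℝ) ^ K = (3 / 5) ^ K * 5 ^ K := by
        rw [← mul_pow]; norm_num
      rw [pow_succ (3 / 5 : ℝ), pow_succ (3 : ℝ), e1, hp, hq, hr]
      ring
    · intro x y hx hy hxy
      rw [H]
      by_cases hx2 : 2 ^ K ≤ x
      · have hx3 : x = 2 ^ K := by omega
        have hy3 : y = 0 := by omega
        subst hx3; subst hy3
        rw [if_pos le_rfl]
        simp only [sub_self, zero_add]
        rw [(H_corners _ _ _ _ _).2.2, (H_corners _ _ _ _ _).2.1]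
      · rw [if_neg hx2, if_pos (by omega), add_sub_cancel_right]
    · intro x y hx hy hxy
      rw [H, if_pos (by omega), add_sub_cancel_right]
    · intro x y hx hy hxy
      rw [H]
      by_cases hx2 : 2 ^ K ≤ x
      · have hx3 : x = 2 ^ K := by omega
        have hy3 : y = 0 := by omega
        subst hx3; subst hy3
        rw [if_pos le_rfl, sub_self, (H_corners _ _ _ _ _).1, (H_corners _ _ _ _ _).2.1]
      · rw [if_neg hx2]
        by_cases hy2 : 2 ^ K ≤ y
        · have hx3 : y = 2 ^ K := by omega
          have hy3 : x = 0 := by omega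
          subst hx3; subst hy3
          rw [if_pos le_rfl, sub_self, (H_corners _ _ _ _ _).1, (H_corners _ _ _ _ _).2.2]
        · rw [if_neg hy2]

/-- Lower bounds. -/
lemma H_ge (K : ℕ) (A B C c : ℝ) (hA : c + 2 * 5 ^ K ≤ A) (hB : c ≤ B) (hC : c ≤ C) (a b : ℤ) :
    c ≤ H 1 K A B C a b := by
  induction K generalizing A B C a b with
  | zero =>
    unfold H; split_ifs
    · exact hB
    · exact hC
    · norm_num at hA; linarith
  | succ K ih =>
    have h5 : (0 : ℝ) < 5 ^ K := by positivity
    rw [pow_succ] at hA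
    rw [H]; split_ifs
    · apply ih <;> linarith
    · apply ih <;> linarith
    · apply ih <;> linarith

lemma H_ge_dist (K j : ℕ) (hjK : j ≤ K) (A B C : ℝ) (hA : 2 * 5 ^ K ≤ A) (hB : 0 ≤ B)
    (hC : 0 ≤ C) (a b : ℤ) (ha : 0 ≤ a) (hb : 0 ≤ b) (hab : a + b + 2 ^ j ≤ 2 ^ K) :
    2 * 5 ^ j ≤ H 1 K A B C a b := by
  induction K, hjK using Nat.le_induction generalizing A B C a b with
  | base =>
    have h1 : a = 0 := by omega
    have h2 : b = 0 := by omega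
    subst h1; subst h2
    rw [(H_corners _ _ _ _ _).1]; exact hA
  | succ K hK ih =>
    have h5 : (0 : ℝ) < 5 ^ K := by positivity
    have h2 : (2 : ℤ) ^ (K + 1) = 2 * 2 ^ K := by ring
    have hj : (5 : ℝ) ^ j ≤ 5 ^ K := pow_le_pow_right₀ (by norm_num) hK
    rw [pow_succ] at hA
    rw [H]; split_ifs
    · apply ih
      any_goals omega
      all_goals linarith
    · apply ih
      any_goals omega
      all_goals linarith
    · apply H_ge <;> linarith

lemma H_bounds (K : ℕ) (A B C X : ℝ) (hA : 0 ≤ A) (hB : 0 ≤ B) (hC : 0 ≤ C)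
    (hA' : A ≤ X) (hB' : B ≤ X) (hC' : C ≤ X) (a b : ℤ) :
    0 ≤ H (-1) K A B C a b ∧ H (-1) K A B C a b ≤ X + 5 ^ K / 2 := by
  induction K generalizing A B C X a b with
  | zero => unfold H; split_ifs <;> constructor <;> norm_num <;> linarith
  | succ K ih =>
    have h5 : (0 : ℝ) < 5 ^ K := by positivity
    have e : X + 5 ^ (K + 1) / 2 = (X + 2 * 5 ^ K) + 5 ^ K / 2 := by ring
    rw [H, e]; split_ifs <;> apply ih <;> linarith

/-- Number of triangles of the level-`K` gasket with height less than `n`. -/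
noncomputable def Nn : ℕ → ℕ → ℝ
  | 0, n => if n = 0 then 0 else 1
  | K + 1, n => if n ≤ 2 ^ K then Nn K n else 3 ^ K + 2 * Nn K (n - 2 ^ K)

/-- The odometer function. -/
noncomputable def W : ℕ → ℕ → ℤ → ℤ → ℝ
  | 0, n, a, b => if n = 0 then 0 else if a = 0 ∧ b = 0 then 2 else 0
  | K + 1, n, a, b =>
    if n ≤ 2 ^ K then W K n a b
    else if 2 ^ K ≤ a then W K (n - 2 ^ K) (a - 2 ^ K) b
    else if 2 ^ K ≤ b then W K (n - 2 ^ K) a (b - 2 ^ K)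
    else if a + b ≤ 2 ^ K then
      H 1 K (W K (n - 2 ^ K) 0 0 + (5 / 3) ^ K * (6 * Nn K (n - 2 ^ K) + 2 * 3 ^ K))
        (W K (n - 2 ^ K) 0 0) (W K (n - 2 ^ K) 0 0) a b
    else 0

lemma Nn_nonneg (K n : ℕ) : 0 ≤ Nn K n := by
  induction K generalizing n with
  | zero => unfold Nn; split_ifs <;> norm_num
  | succ K ih =>
    unfold Nn; split_ifs
    · exact ih n
    · have := ih (n - 2 ^ K); positivity

lemma Nn_full (K : ℕ) : Nn K (2 ^ K) = 3 ^ K := by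
  induction K with
  | zero => simp [Nn]
  | succ K ih =>
    have h : (2 : ℕ) ^ (K + 1) = 2 * 2 ^ K := by ring
    have h3 : (0 : ℕ) < 2 ^ K := by positivity
    rw [Nn, if_neg (by omega), h, show 2 * 2 ^ K - 2 ^ K = 2 ^ K by omega, ih]; ring

lemma Nn_one (K : ℕ) : Nn K 1 = 1 := by
  induction K with
  | zero => simp [Nn]
  | succ K ih => rw [Nn, if_pos Nat.one_le_two_pow, ih]

lemma Nn_zero (K : ℕ) : Nn K 0 = 0 := by
  induction K with
  | zero => simp [Nn]
  | succ K ih => rw [Nn, if_pos (Nat.zero_le _), ih]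

lemma Nn_diff (K n : ℕ) (hn : n + 1 ≤ 2 ^ K) : Nn K (n + 1) - Nn K n ≤ 2 ^ K := by
  induction K generalizing n with
  | zero =>
    have : n = 0 := by simpa using hn
    subst this; simp [Nn]
  | succ K ih =>
    have h : (2 : ℕ) ^ (K + 1) = 2 * 2 ^ K := by ring
    have h1 : (1 : ℝ) ≤ 2 ^ K := one_le_pow₀ (by norm_num)
    rw [pow_succ (2 : ℝ)]
    by_cases h2 : n + 1 ≤ 2 ^ K
    · rw [Nn, Nn, if_pos h2, if_pos (by omega)]
      have := ih n h2; linarith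
    · by_cases h3 : n ≤ 2 ^ K
      · have h4 : n = 2 ^ K := by omega
        rw [Nn, Nn, if_neg h2, if_pos h3, h4, Nn_full,
          show 2 ^ K + 1 - 2 ^ K = 1 by omega, Nn_one]
        linarith
      · rw [Nn, Nn, if_neg h2, if_neg h3, show n + 1 - 2 ^ K = (n - 2 ^ K) + 1 by omega]
        have := ih (n - 2 ^ K) (by omega)
        linarith

lemma Nn_lower (K n : ℕ) (hn : 2 ^ K < n) : 3 ^ K ≤ Nn (K + 1) n := by
  rw [Nn, if_neg (by omega)]
  have := Nn_nonneg K (n - 2 ^ K)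
  linarith

lemma W_zero (K n : ℕ) (hn : n ≤ 2 ^ K) (a b : ℤ) (ha : 0 ≤ a) (hb : 0 ≤ b)
    (hab : (n : ℤ) ≤ a + b) : W K n a b = 0 := by
  induction K generalizing n a b with
  | zero =>
    rw [W]
    split_ifs
    · rfl
    · omega
    · rfl
  | succ K ih =>
    have h : (2 : ℕ) ^ (K + 1) = 2 * 2 ^ K := by ring
    have hc : ((2 ^ K : ℕ) : ℤ) = 2 ^ K := by push_cast; ring
    rw [W]
    split_ifs with h1 h2 h3 h4
    · exact ih n h1 a b ha hb hab
    · exact ih _ (by omega) _ _ (by omega) hb (by omega)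
    · exact ih _ (by omega) _ _ ha (by omega) (by omega)
    · omega
    · rfl

lemma five_three (K : ℕ) (x : ℝ) (hx : 0 ≤ x) :
    2 * 5 ^ K ≤ (5 / 3 : ℝ) ^ K * (6 * x + 2 * 3 ^ K) := by
  have e : (5 : ℝ) ^ K = (5 / 3) ^ K * 3 ^ K := by rw [← mul_pow]; norm_num
  have : (0 : ℝ) ≤ (5 / 3) ^ K * x := by positivity
  rw [e]; linarith

lemma W_nonneg (K n : ℕ) (a b : ℤ) : 0 ≤ W K n a b := by
  induction K generalizing n a b with
  | zero => rw [W]; split_ifs <;> norm_num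
  | succ K ih =>
    rw [W]
    split_ifs with h1 h2 h3 h4
    · exact ih _ _ _
    · exact ih _ _ _
    · exact ih _ _ _
    · have h5 := five_three K _ (Nn_nonneg K (n - 2 ^ K))
      have h6 := ih (n - 2 ^ K) 0 0
      apply H_ge <;> linarith
    · exact le_rfl

lemma W_origin (K n j : ℕ) (hn : n ≤ 2 ^ K) (hj : 2 ^ (j + 1) ≤ n) :
    2 * 5 ^ j ≤ W K n 0 0 := by
  induction K generalizing n with
  | zero =>
    have : 1 < 2 ^ (j + 1) := Nat.one_lt_two_pow (by omega)
    simp at hn; omega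
  | succ K ih =>
    have h3 : (0 : ℤ) < 2 ^ K := by positivity
    rw [W]
    by_cases h1 : n ≤ 2 ^ K
    · rw [if_pos h1]; exact ih n h1 hj
    · rw [if_neg h1, if_neg (by omega), if_neg (by omega), if_pos (by omega),
        (H_corners _ _ _ _ _).1]
      have h5 := five_three K _ (Nn_nonneg K (n - 2 ^ K))
      have h6 := W_nonneg K (n - 2 ^ K) 0 0
      have hjK : j + 1 ≤ K + 1 := (Nat.pow_le_pow_iff_right (by norm_num)).1 (hj.trans hn)
      have hj : (5 : ℝ) ^ j ≤ 5 ^ K := pow_le_pow_right₀ (by norm_num) (by omega)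
      linarith

lemma W_lower (K n j : ℕ) (hn : n ≤ 2 ^ K) (a b : ℤ) (ha : 0 ≤ a) (hb : 0 ≤ b)
    (hr : ¬ (a + b > 2 ^ K))
    (hT : Mm K a b ≠ 0) (hab : a + b + 3 * 2 ^ j ≤ n) :
    2 * 5 ^ j ≤ W K n a b := by
  induction K generalizing n a b with
  | zero =>
    have : (0 : ℤ) < 2 ^ j := by positivity
    simp at hn; omega
  | succ K ih =>
    have h : (2 : ℤ) ^ (K + 1) = 2 * 2 ^ K := by ring
    have h' : (2 : ℕ) ^ (K + 1) = 2 * 2 ^ K := by ring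
    have hc : ((2 ^ K : ℕ) : ℤ) = 2 ^ K := by push_cast; ring
    have hcj : ((2 ^ (j + 1) : ℕ) : ℤ) = 2 * 2 ^ j := by push_cast; ring
    have hj0 : (0 : ℤ) < 2 ^ j := by positivity
    rw [Mm_succ] at hT
    rw [W]
    split_ifs with h1 h2 h3 h4
    · have e1 : Mm K (a - 2 ^ K) b = 0 := Mm_out (by omega)
      have e2 : Mm K a (b - 2 ^ K) = 0 := Mm_out (by omega)
      rw [e1, e2] at hT
      exact ih n h1 a b ha hb (by omega) (by simpa using hT) hab
    · by_cases hm : Mm K (a - 2 ^ K) b = 0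
      · exfalso
        apply hT
        rw [hm]
        by_cases hc1 : a = 2 ^ K ∧ b = 0
        · obtain ⟨rfl, rfl⟩ := hc1
          exfalso
          revert hm
          simp only [sub_self]
          have : chi K 0 0 = 1 := by
            clear * -
            induction K with
            | zero => simp [chi, T]
            | succ K ih =>
              have h3 : (0 : ℤ) < 2 ^ K := by positivity
              rw [chi_succ, ih, chi_zero (by omega), chi_zero (by omega)]; norm_num
          unfold Mm
          rw [this, chi_zero (by omega), chi_zero (by omega)]
          norm_num
        · by_cases hc2 : a = 2 ^ K ∧ b = 2 ^ K
          · omega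
          · rw [Mm_out (by omega), Mm_out (by omega)]; ring
      · exact ih _ (by omega) _ _ (by omega) hb (by omega) hm (by omega)
    · have e0 : b = 2 ^ K ∧ a = 0 ∨ Mm K a b = 0 := by
        by_cases hq : b = 2 ^ K ∧ a = 0
        · exact Or.inl hq
        · exact Or.inr (Mm_out (by omega))
      have e1 : Mm K (a - 2 ^ K) b = 0 := Mm_out (by omega)
      have hm : Mm K a (b - 2 ^ K) ≠ 0 := by
        rcases e0 with ⟨rfl, rfl⟩ | e0
        · simp only [sub_self]
          have : chi K 0 0 = 1 := by
            clear * -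
            induction K with
            | zero => simp [chi, T]
            | succ K ih =>
              have h3 : (0 : ℤ) < 2 ^ K := by positivity
              rw [chi_succ, ih, chi_zero (by omega), chi_zero (by omega)]; norm_num
          unfold Mm
          rw [this, chi_zero (by omega), chi_zero (by omega)]
          norm_num
        · rw [e0, e1] at hT; simpa using hT
      exact ih _ (by omega) _ _ ha (by omega) (by omega) hm (by omega)
    · have h5 := five_three K _ (Nn_nonneg K (n - 2 ^ K))
      have h6 := W_nonneg K (n - 2 ^ K) 0 0
      by_cases hn2 : 2 ^ (j + 1) ≤ n - 2 ^ K
      · have h7 := W_origin K (n - 2 ^ K) j (by omega) hn2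
        refine h7.trans ?_
        apply H_ge <;> linarith
      · have hab2 : a + b + 2 ^ j ≤ 2 ^ K := by omega
        have hjK : j ≤ K := by
          by_contra hh
          have : (2 : ℤ) ^ K < 2 ^ j := pow_lt_pow_right₀ (by norm_num) (by omega)
          omega
        apply H_ge_dist K j hjK _ _ _ (by linarith) h6 h6 a b ha hb hab2
    · exfalso
      apply hT
      rw [Mm_out (by omega), Mm_out (by omega), Mm_out (by omega)]; ring

lemma Lam_W (K n : ℕ) (hn : n ≤ 2 ^ K) (a b : ℤ) (hab : a + b < n) :
    Lam K (W K n) a b = 2 * Mm K a b - 6 * Nn K n * dl a b 0 0 := by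
  induction K generalizing n a b with
  | zero =>
    simp at hn
    by_cases h0 : a = 0 ∧ b = 0
    · obtain ⟨rfl, rfl⟩ := h0
      have : n = 1 := by omega
      subst this
      simp [Lam, Mm, chi, T, W, dl, Nn]; norm_num
    · have e1 : ¬ (a - 1 = 0 ∧ b = 0) := by omega
      have e2 : ¬ (a = 0 ∧ b - 1 = 0) := by omega
      simp [Lam, Mm, chi, T, dl, h0, e1, e2]
  | succ K ih =>
    have h : (2 : ℤ) ^ (K + 1) = 2 * 2 ^ K := by ring
    have h' : (2 : ℕ) ^ (K + 1) = 2 * 2 ^ K := by ring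
    have hc : ((2 ^ K : ℕ) : ℤ) = 2 ^ K := by push_cast; ring
    have h3 : (0 : ℤ) < 2 ^ K := by positivity
    rw [Lam_succ, Mm_succ, Nn]
    by_cases h1 : n ≤ 2 ^ K
    · rw [if_pos h1, Lam_out (a := a - 2 ^ K) (by omega), Lam_out (b := b - 2 ^ K) (by omega),
        Mm_out (a := a - 2 ^ K) (by omega), Mm_out (b := b - 2 ^ K) (by omega)]
      rw [Lam_congr K (W (K + 1) n) (W K n), ih n h1 a b hab]
      · ring
      · intro x y _ _ _
        rw [W, if_pos h1]
    · rw [if_neg h1]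
      set y0 := W K (n - 2 ^ K) 0 0 with hy0
      set N' := Nn K (n - 2 ^ K) with hN'
      rw [Lam_congr K (W (K + 1) n) (H 1 K (y0 + (5 / 3) ^ K * (6 * N' + 2 * 3 ^ K)) y0 y0)]
      rw [Lam_congr K (fun x y => W (K + 1) n (x + 2 ^ K) y) (W K (n - 2 ^ K))]
      rw [Lam_congr K (fun x y => W (K + 1) n x (y + 2 ^ K)) (W K (n - 2 ^ K))]
      · rw [Lam_H, ih _ (by omega) _ _ (by omega), ih _ (by omega) _ _ (by omega)]
        have d1 : dl (a - 2 ^ K) b 0 0 = dl a b (2 ^ K) 0 := by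
          unfold dl; congr 1; apply propext; constructor <;> omega
        have d4 : dl a (b - 2 ^ K) 0 0 = dl a b 0 (2 ^ K) := by
          unfold dl; congr 1; apply propext; constructor <;> omega
        rw [d1, d4]
        have e1 : (3 / 5 : ℝ) ^ K * (5 / 3) ^ K = 1 := by
          rw [← mul_pow]; norm_num
        linear_combination (6 * N' + 2 * 3 ^ K) * (dl a b (2 ^ K) 0 + dl a b 0 (2 ^ K)
          - 2 * dl a b 0 0) * e1
      · intro x y hx hy hxy
        rw [W, if_neg h1]
        by_cases hx2 : 2 ^ K ≤ x
        · rw [if_pos hx2, W_zero K _ (by omega) _ _ (by omega) (by omega) (by omega),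
            W_zero K _ (by omega) _ _ (by omega) (by omega) (by omega)]
        · rw [if_neg hx2, if_pos (by omega), add_sub_cancel_right]
      · intro x y hx hy hxy
        rw [W, if_neg h1, if_pos (by omega), add_sub_cancel_right]
      · intro x y hx hy hxy
        rw [W, if_neg h1]
        by_cases hx2 : 2 ^ K ≤ x
        · have hx3 : x = 2 ^ K := by omega
          have hy3 : y = 0 := by omega
          subst hx3; subst hy3
          rw [if_pos le_rfl, sub_self, (H_corners _ _ _ _ _).2.1]
        · rw [if_neg hx2]
          by_cases hy2 : 2 ^ K ≤ y
          · have hx3 : y = 2 ^ K := by omega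
            have hy3 : x = 0 := by omega
            subst hx3; subst hy3
            rw [if_pos le_rfl, sub_self, (H_corners _ _ _ _ _).2.2]
          · rw [if_neg hy2, if_pos hxy]

end Model

section Counting

lemma T_origin (K : ℕ) : T K 0 0 := by
  induction K with
  | zero => exact ⟨rfl, rfl⟩
  | succ K ih => exact Or.inl ih

lemma T_mono {K L : ℕ} (h : K ≤ L) {a b : ℤ} (ht : T K a b) : T L a b := by
  induction L, h using Nat.le_induction with
  | base => exact ht
  | succ L _ ih => exact Or.inl ih

lemma T_stable {K L : ℕ} {a b : ℤ} (ht : T L a b) (hab : a + b < 2 ^ K) : T K a b := by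
  rcases le_total L K with h | h
  · exact T_mono h ht
  · induction L, h using Nat.le_induction with
    | base => exact ht
    | succ L hL ih =>
      have h2 : (2 : ℤ) ^ K ≤ 2 ^ L := pow_le_pow_right₀ (by norm_num) hL
      rcases ht with ht | ht | ht
      · exact ih ht
      · have := T_region ht; omega
      · have := T_region ht; omega

/-- The triangle with bottom `(a,b)` belongs to the infinite gasket. -/
def TT (a b : ℤ) : Prop := ∃ K, T K a b

lemma TT_iff {K : ℕ} {a b : ℤ} (hab : a + b < 2 ^ K) : TT a b ↔ T K a b :=
  ⟨fun ⟨_, h⟩ => T_stable h hab, fun h => ⟨K, h⟩⟩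

lemma TT_nonneg {a b : ℤ} (h : TT a b) : 0 ≤ a ∧ 0 ≤ b := by
  obtain ⟨K, h⟩ := h
  exact ⟨(T_region h).1, (T_region h).2.1⟩

/-- `(a,b)` is a corner of the level-`K` block. -/
def Cor (K : ℕ) (a b : ℤ) : Prop := (a = 0 ∧ b = 0) ∨ (a = 2 ^ K ∧ b = 0) ∨ (a = 0 ∧ b = 2 ^ K)

set_option maxHeartbeats 2000000 in
lemma Mm_cases (K : ℕ) (a b : ℤ) :
    (Mm K a b = 0 ∧ ¬ Cor K a b) ∨
      (Mm K a b = 2 ∧ ¬ Cor K a b ∧ 0 ≤ a ∧ 0 ≤ b ∧ a + b ≤ 2 ^ K) ∨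
      (Mm K a b = 1 ∧ Cor K a b) := by
  induction K generalizing a b with
  | zero =>
    by_cases h0 : a = 0 ∧ b = 0
    · obtain ⟨rfl, rfl⟩ := h0
      simp [Mm, chi, T, Cor]
    · by_cases h1 : a = 1 ∧ b = 0
      · obtain ⟨rfl, rfl⟩ := h1
        simp [Mm, chi, T, Cor]
      · by_cases h2 : a = 0 ∧ b = 1
        · obtain ⟨rfl, rfl⟩ := h2
          simp [Mm, chi, T, Cor]
        · have e1 : ¬ (a - 1 = 0 ∧ b = 0) := by omega
          have e2 : ¬ (a = 0 ∧ b - 1 = 0) := by omega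
          left
          simp [Mm, chi, T, Cor, h0, h1, h2, e1, e2]
  | succ K ih =>
    have h : (2 : ℤ) ^ (K + 1) = 2 * 2 ^ K := by ring
    have h3 : (0 : ℤ) < 2 ^ K := by positivity
    have i1 := ih a b
    have i2 := ih (a - 2 ^ K) b
    have i3 := ih a (b - 2 ^ K)
    clear ih
    rw [Mm_succ]
    unfold Cor at *
    rw [h]
    generalize (2 : ℤ) ^ K = t at *
    rcases i1 with ⟨e1, f1⟩ | ⟨e1, f1⟩ | ⟨e1, f1⟩ <;>
    rcases i2 with ⟨e2, f2⟩ | ⟨e2, f2⟩ | ⟨e2, f2⟩ <;>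
    rcases i3 with ⟨e3, f3⟩ | ⟨e3, f3⟩ | ⟨e3, f3⟩ <;>
    rw [e1, e2, e3] <;>
    first
    | (exfalso; omega)
    | (refine Or.inl (And.intro ?_ ?_); norm_num; omega)
    | (refine Or.inr (Or.inl (And.intro ?_ ?_)); norm_num; omega)
    | (refine Or.inr (Or.inr (And.intro ?_ ?_)); norm_num; omega)

/-- Vertices of the one-sided gasket. -/
def CV (a b : ℤ) : Prop := TT a b ∨ TT (a - 1) b ∨ TT a (b - 1)

lemma CV_nonneg {a b : ℤ} (h : CV a b) : 0 ≤ a ∧ 0 ≤ b := by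
  rcases h with h | h | h <;> have := TT_nonneg h <;> omega

lemma CV_iff {K : ℕ} {a b : ℤ} (hab : a + b < 2 ^ K) : CV a b ↔ Mm K a b ≠ 0 := by
  unfold CV Mm
  rw [TT_iff hab, TT_iff (K := K) (a := a - 1) (b := b) (by omega),
    TT_iff (K := K) (a := a) (b := b - 1) (by omega)]
  unfold chi
  by_cases h1 : T K a b <;> by_cases h2 : T K (a - 1) b <;> by_cases h3 : T K a (b - 1) <;>
    simp [h1, h2, h3] <;> norm_num

/-- Vertices of the doubly infinite gasket. -/
def DV (a b : ℤ) : Prop := CV a b ∨ CV (-a) (-b)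

lemma Mm_two {K : ℕ} {a b : ℤ} (hab : |a| + |b| < 2 ^ K) :
    Mm K a b + Mm K (-a) (-b) = if DV a b then 2 else 0 := by
  have ha1 := le_abs_self a
  have ha2 := neg_le_abs a
  have hb1 := le_abs_self b
  have hb2 := neg_le_abs b
  have c1 := Mm_cases K a b
  have c2 := Mm_cases K (-a) (-b)
  unfold DV
  rw [CV_iff (K := K) (by omega), CV_iff (K := K) (by omega)]
  have h3 : (0 : ℤ) < 2 ^ K := by positivity
  unfold Cor at c1 c2
  generalize (2 : ℤ) ^ K = t at *
  rcases c1 with ⟨e1, f1⟩ | ⟨e1, f1⟩ | ⟨e1, f1⟩ <;>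
  rcases c2 with ⟨e2, f2⟩ | ⟨e2, f2⟩ | ⟨e2, f2⟩ <;>
  rw [e1, e2] <;>
  first
  | (exfalso; omega)
  | (norm_num)

lemma hasSum_Nn (K n : ℕ) (hn : n ≤ 2 ^ K) :
    HasSum (fun v : ℤ × ℤ => if v.1 + v.2 < (n : ℤ) then chi K v.1 v.2 else 0) (Nn K n) := by
  induction K generalizing n with
  | zero =>
    have h := hasSum_single
      (f := fun v : ℤ × ℤ => if v.1 + v.2 < (n : ℤ) then chi 0 v.1 v.2 else 0) (0, 0) (by
        rintro ⟨a, b⟩ hab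
        have : ¬ (a = 0 ∧ b = 0) := fun h => hab (by rw [h.1, h.2])
        simp [chi, T, this])
    convert h using 1
    rcases Nat.eq_zero_or_pos n with h0 | h0
    · subst h0; simp [Nn]
    · have : n = 1 := by simp at hn; omega
      subst this; simp [Nn, chi, T]
  | succ K ih =>
    have h : (2 : ℕ) ^ (K + 1) = 2 * 2 ^ K := by ring
    have hc : ((2 ^ K : ℕ) : ℤ) = 2 ^ K := by push_cast; ring
    rw [Nn]
    split_ifs with h1
    · convert ih n h1 using 1
      funext v
      rw [chi_succ]
      split_ifs with h2
      · by_cases hr : 0 ≤ v.1 ∧ 0 ≤ v.2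
        · rw [chi_zero (a := v.1 - 2 ^ K) (by omega), chi_zero (b := v.2 - 2 ^ K) (by omega)]; ring
        · rw [chi_zero (a := v.1 - 2 ^ K) (by omega), chi_zero (b := v.2 - 2 ^ K) (by omega)]; ring
      · rfl
    · have s0 := ih (2 ^ K) le_rfl
      have s1 := ih (n - 2 ^ K) (by omega)
      have s2 := (Equiv.hasSum_iff (Equiv.addRight ((-2 ^ K, 0) : ℤ × ℤ))).2 s1
      have s3 := (Equiv.hasSum_iff (Equiv.addRight ((0, -2 ^ K) : ℤ × ℤ))).2 s1
      rw [Nn_full] at s0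
      have s4 := (s0.add s2).add s3
      convert s4 using 1
      · funext v
        simp only [Function.comp, Equiv.coe_addRight, Prod.fst_add, Prod.snd_add, add_zero]
        rw [chi_succ, ← sub_eq_add_neg, ← sub_eq_add_neg]
        have hcast : ((n - 2 ^ K : ℕ) : ℤ) = n - 2 ^ K := by
          rw [Nat.cast_sub (by omega), hc]
        rw [hcast, hc]
        by_cases h2 : v.1 + v.2 < (n : ℤ)
        · rw [if_pos h2, if_pos (show v.1 - 2 ^ K + v.2 < (n : ℤ) - 2 ^ K by omega),
            if_pos (show v.1 + (v.2 - 2 ^ K) < (n : ℤ) - 2 ^ K by omega)]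
          congr 2
          split_ifs with h4
          · rfl
          · exact chi_zero (by omega)
        · rw [if_neg h2, if_neg (show ¬ v.1 + v.2 < 2 ^ K by omega),
            if_neg (show ¬ v.1 - 2 ^ K + v.2 < (n : ℤ) - 2 ^ K by omega),
            if_neg (show ¬ v.1 + (v.2 - 2 ^ K) < (n : ℤ) - 2 ^ K by omega)]; ring
      · ring

lemma hasSum_DV (K n : ℕ) (hn : n + 1 ≤ 2 ^ K) :
    HasSum (fun v : ℤ × ℤ => if |v.1| + |v.2| < ((n + 1 : ℕ) : ℤ) ∧ DV v.1 v.2 then (1 : ℝ) else 0)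
      (Nn K (n + 1) + 2 * Nn K n) := by
  have hc : ((2 ^ K : ℕ) : ℤ) = 2 ^ K := by push_cast; ring
  have s0 := hasSum_Nn K (n + 1) hn
  have s1 := hasSum_Nn K n (by omega)
  have s2 := (Equiv.hasSum_iff (Equiv.addRight ((-1, 0) : ℤ × ℤ))).2 s1
  have s3 := (Equiv.hasSum_iff (Equiv.addRight ((0, -1) : ℤ × ℤ))).2 s1
  have s4 := (s0.add s2).add s3
  have s5 : HasSum (fun v : ℤ × ℤ => if v.1 + v.2 < ((n + 1 : ℕ) : ℤ) then Mm K v.1 v.2 else 0)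
      (Nn K (n + 1) + 2 * Nn K n) := by
    convert s4 using 1
    · funext v
      simp only [Function.comp, Equiv.coe_addRight, Prod.fst_add, Prod.snd_add, add_zero]
      rw [← sub_eq_add_neg, ← sub_eq_add_neg]
      push_cast
      unfold Mm
      by_cases h2 : v.1 + v.2 < (n : ℤ) + 1
      · rw [if_pos h2, if_pos h2, if_pos (by omega), if_pos (by omega)]
      · rw [if_neg h2, if_neg h2, if_neg (by omega), if_neg (by omega)]; ring
    · ring
  have s6 := (Equiv.hasSum_iff (Equiv.neg (ℤ × ℤ))).2 s5
  have s7 := (s5.add s6).mul_left (1 / 2)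
  convert s7 using 1
  · rfl
  · funext v
    obtain ⟨a, b⟩ := v
    simp only [Function.comp, Equiv.neg_apply, Prod.fst_neg, Prod.snd_neg]
    by_cases hab : |a| + |b| < ((n + 1 : ℕ) : ℤ)
    · have ha1 := le_abs_self a
      have ha2 := neg_le_abs a
      have hb1 := le_abs_self b
      have hb2 := neg_le_abs b
      have hm := Mm_two (K := K) (a := a) (b := b) (by omega)
      rw [if_pos (show a + b < ((n + 1 : ℕ) : ℤ) by omega),
        if_pos (show -a + -b < ((n + 1 : ℕ) : ℤ) by omega), hm]
      by_cases hd : DV a b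
      · rw [if_pos ⟨hab, hd⟩, if_pos hd]; norm_num
      · rw [if_neg (fun h => hd h.2), if_neg hd]; norm_num
    · rw [if_neg (fun h => hab h.1)]
      have e1 : (if a + b < ((n + 1 : ℕ) : ℤ) then Mm K a b else 0) = 0 := by
        split_ifs with h
        · apply Mm_out
          rintro ⟨h1, h2, _⟩
          rw [abs_of_nonneg h1, abs_of_nonneg h2] at hab
          omega
        · rfl
      have e2 : (if -a + -b < ((n + 1 : ℕ) : ℤ) then Mm K (-a) (-b) else 0) = 0 := by
        split_ifs with h
        · apply Mm_out
          rintro ⟨h1, h2, _⟩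
          rw [abs_of_nonpos (by omega), abs_of_nonpos (by omega)] at hab
          omega
        · rfl
      rw [e1, e2]; norm_num
  · ring

end Counting

section Interface

/-- Embedding of the triangular lattice in the plane. -/
noncomputable def io (a b : ℤ) : ℝ × ℝ := ((a : ℝ) + b / 2, (b : ℝ) / 2 * Real.sqrt 3)

lemma io_inj {a b c d : ℤ} (h : io a b = io c d) : a = c ∧ b = d := by
  unfold io at h
  rw [Prod.mk.injEq] at h
  have h3 : Real.sqrt 3 ≠ 0 := by positivity
  have h2 : (b : ℝ) / 2 = d / 2 := mul_right_cancel₀ h3 h.2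
  have hb : (b : ℝ) = d := by linarith
  have ha : (a : ℝ) = c := by linarith [h.1]
  exact ⟨by exact_mod_cast ha, by exact_mod_cast hb⟩

lemma io_add (a b c d : ℤ) : io a b + io c d = io (a + c) (b + d) := by
  unfold io
  ext
  · simp; ring
  · simp; ring

lemma io_neg (a b : ℤ) : -io a b = io (-a) (-b) := by
  unfold io
  ext
  · simp; ring
  · simp; ring

lemma io_x (K : ℕ) : ((2 : ℝ) ^ K, (0 : ℝ)) = io (2 ^ K) 0 := by
  unfold io; simp

lemma io_y (K : ℕ) : ((2 : ℝ) ^ K / 2, (2 : ℝ) ^ K / 2 * Real.sqrt 3) = io 0 (2 ^ K) := by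
  unfold io; simp

lemma gasketV_iff (K : ℕ) (p : ℝ × ℝ) : p ∈ gasketV K ↔
    ∃ a b, T K a b ∧ (p = io a b ∨ p = io (a + 1) b ∨ p = io a (b + 1)) := by
  induction K generalizing p with
  | zero =>
    have e0 : io 0 0 = (0, 0) := by simp [io]
    have e1 : io (0 + 1) 0 = (1, 0) := by simp [io]
    have e2 : io 0 (0 + 1) = (1 / 2, Real.sqrt 3 / 2) := by simp [io]; ring
    simp only [gasketV, Set.mem_insert_iff, Set.mem_singleton_iff]
    constructor
    · intro h
      exact ⟨0, 0, ⟨rfl, rfl⟩, by rw [e0, e1, e2]; exact h⟩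
    · rintro ⟨a, b, ⟨rfl, rfl⟩, h⟩
      rw [e0, e1, e2] at h; exact h
  | succ K ih =>
    simp only [gasketV, trSet, io_x, io_y, Set.mem_union, Set.mem_image]
    constructor
    · rintro ((h | ⟨q, h, rfl⟩) | ⟨q, h, rfl⟩)
      · obtain ⟨a, b, ht, h⟩ := (ih p).1 h
        exact ⟨a, b, Or.inl ht, h⟩
      · obtain ⟨a, b, ht, h⟩ := (ih q).1 h
        refine ⟨2 ^ K + a, b, Or.inr (Or.inl (by simpa using ht)), ?_⟩
        rcases h with rfl | rfl | rfl
        · left; rw [io_add, zero_add]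
        · right; left; rw [io_add, zero_add, add_assoc]
        · right; right; rw [io_add, zero_add]
      · obtain ⟨a, b, ht, h⟩ := (ih q).1 h
        refine ⟨a, 2 ^ K + b, Or.inr (Or.inr (by simpa using ht)), ?_⟩
        rcases h with rfl | rfl | rfl
        · left; rw [io_add, zero_add]
        · right; left; rw [io_add, zero_add]
        · right; right; rw [io_add, zero_add, add_assoc]
    · rintro ⟨a, b, ht | ht | ht, h⟩
      · left; left; exact (ih p).2 ⟨a, b, ht, h⟩
      · left; right
        rcases h with rfl | rfl | rfl
        · exact ⟨io (a - 2 ^ K) b, (ih _).2 ⟨_, _, ht, Or.inl rfl⟩, by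
            rw [io_add]; congr 1 <;> ring⟩
        · exact ⟨io (a - 2 ^ K + 1) b, (ih _).2 ⟨_, _, ht, Or.inr (Or.inl rfl)⟩, by
            rw [io_add]; congr 1 <;> ring⟩
        · exact ⟨io (a - 2 ^ K) (b + 1), (ih _).2 ⟨_, _, ht, Or.inr (Or.inr rfl)⟩, by
            rw [io_add]; congr 1 <;> ring⟩
      · right
        rcases h with rfl | rfl | rfl
        · exact ⟨io a (b - 2 ^ K), (ih _).2 ⟨_, _, ht, Or.inl rfl⟩, by
            rw [io_add]; congr 1 <;> ring⟩
        · exact ⟨io (a + 1) (b - 2 ^ K), (ih _).2 ⟨_, _, ht, Or.inr (Or.inl rfl)⟩, by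
            rw [io_add]; congr 1 <;> ring⟩
        · exact ⟨io a (b - 2 ^ K + 1), (ih _).2 ⟨_, _, ht, Or.inr (Or.inr rfl)⟩, by
            rw [io_add]; congr 1 <;> ring⟩

lemma gasketE_iff (K : ℕ) (p q : ℝ × ℝ) : (p, q) ∈ gasketE K ↔
    ∃ a b, T K a b ∧ ((p = io a b ∧ q = io (a + 1) b) ∨ (p = io a b ∧ q = io a (b + 1)) ∨
      (p = io (a + 1) b ∧ q = io a (b + 1))) := by
  induction K generalizing p q with
  | zero =>
    have e0 : io 0 0 = (0, 0) := by simp [io]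
    have e1 : io (0 + 1) 0 = (1, 0) := by simp [io]
    have e2 : io 0 (0 + 1) = (1 / 2, Real.sqrt 3 / 2) := by simp [io]; ring
    simp only [gasketE, Set.mem_insert_iff, Set.mem_singleton_iff]
    constructor
    · intro h
      refine ⟨0, 0, ⟨rfl, rfl⟩, ?_⟩
      rw [e0, e1, e2]
      simpa only [Prod.mk.injEq (α := ℝ × ℝ) (β := ℝ × ℝ)] using h
    · rintro ⟨a, b, ⟨rfl, rfl⟩, h⟩
      rw [e0, e1, e2] at h
      simpa only [Prod.mk.injEq (α := ℝ × ℝ) (β := ℝ × ℝ)] using h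
  | succ K ih =>
    simp only [gasketE, io_x, io_y, Set.mem_union, Set.mem_image, Prod.mk.injEq]
    constructor
    · rintro ((h | ⟨⟨p, q⟩, h, rfl, rfl⟩) | ⟨⟨p, q⟩, h, rfl, rfl⟩)
      · obtain ⟨a, b, ht, h⟩ := (ih p q).1 h
        exact ⟨a, b, Or.inl ht, h⟩
      · obtain ⟨a, b, ht, h⟩ := (ih p q).1 h
        refine ⟨2 ^ K + a, b, Or.inr (Or.inl (by simpa using ht)), ?_⟩
        rcases h with ⟨rfl, rfl⟩ | ⟨rfl, rfl⟩ | ⟨rfl, rfl⟩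
        · left; simp only [io_add, zero_add, add_assoc, and_self]
        · right; left; simp only [io_add, zero_add, and_self]
        · right; right; simp only [io_add, zero_add, add_assoc, and_self]
      · obtain ⟨a, b, ht, h⟩ := (ih p q).1 h
        refine ⟨a, 2 ^ K + b, Or.inr (Or.inr (by simpa using ht)), ?_⟩
        rcases h with ⟨rfl, rfl⟩ | ⟨rfl, rfl⟩ | ⟨rfl, rfl⟩
        · left; simp only [io_add, zero_add, and_self]
        · right; left; simp only [io_add, zero_add, add_assoc, and_self]
        · right; right; simp only [io_add, zero_add, add_assoc, and_self]
    · rintro ⟨a, b, ht | ht | ht, h⟩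
      · left; left; exact (ih p q).2 ⟨a, b, ht, h⟩
      · left; right
        rcases h with ⟨rfl, rfl⟩ | ⟨rfl, rfl⟩ | ⟨rfl, rfl⟩
        · exact ⟨(_, _), (ih _ _).2 ⟨_, _, ht, Or.inl ⟨rfl, rfl⟩⟩, by
            rw [io_add]; congr 1 <;> ring, by rw [io_add]; congr 1 <;> ring⟩
        · exact ⟨(_, _), (ih _ _).2 ⟨_, _, ht, Or.inr (Or.inl ⟨rfl, rfl⟩)⟩, by
            rw [io_add]; congr 1 <;> ring, by rw [io_add]; congr 1 <;> ring⟩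
        · exact ⟨(_, _), (ih _ _).2 ⟨_, _, ht, Or.inr (Or.inr ⟨rfl, rfl⟩)⟩, by
            rw [io_add]; congr 1 <;> ring, by rw [io_add]; congr 1 <;> ring⟩
      · right
        rcases h with ⟨rfl, rfl⟩ | ⟨rfl, rfl⟩ | ⟨rfl, rfl⟩
        · exact ⟨(_, _), (ih _ _).2 ⟨_, _, ht, Or.inl ⟨rfl, rfl⟩⟩, by
            rw [io_add]; congr 1 <;> ring, by rw [io_add]; congr 1 <;> ring⟩
        · exact ⟨(_, _), (ih _ _).2 ⟨_, _, ht, Or.inr (Or.inl ⟨rfl, rfl⟩)⟩, by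
            rw [io_add]; congr 1 <;> ring, by rw [io_add]; congr 1 <;> ring⟩
        · exact ⟨(_, _), (ih _ _).2 ⟨_, _, ht, Or.inr (Or.inr ⟨rfl, rfl⟩)⟩, by
            rw [io_add]; congr 1 <;> ring, by rw [io_add]; congr 1 <;> ring⟩

lemma gasketV_union_iff (a b : ℤ) : io a b ∈ (⋃ n, gasketV n) ↔ CV a b := by
  simp only [Set.mem_iUnion, gasketV_iff]
  constructor
  · rintro ⟨K, c, d, ht, h | h | h⟩ <;> obtain ⟨rfl, rfl⟩ := io_inj h
    · exact Or.inl ⟨K, ht⟩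
    · exact Or.inr (Or.inl ⟨K, by simpa using ht⟩)
    · exact Or.inr (Or.inr ⟨K, by simpa using ht⟩)
  · rintro (⟨K, h⟩ | ⟨K, h⟩ | ⟨K, h⟩)
    · exact ⟨K, _, _, h, Or.inl rfl⟩
    · exact ⟨K, _, _, h, Or.inr (Or.inl (by rw [sub_add_cancel]))⟩
    · exact ⟨K, _, _, h, Or.inr (Or.inr (by rw [sub_add_cancel]))⟩

lemma io_mem (a b : ℤ) : io a b ∈ SGV ↔ DV a b := by
  unfold SGV DV
  rw [Set.mem_union, Set.mem_neg, io_neg, gasketV_union_iff, gasketV_union_iff]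

lemma exists_coord (x : SGV) : ∃ v : ℤ × ℤ, (x : ℝ × ℝ) = io v.1 v.2 := by
  have key : ∀ p : ℝ × ℝ, p ∈ (⋃ n, gasketV n) → ∃ v : ℤ × ℤ, p = io v.1 v.2 := by
    intro p hp
    obtain ⟨K, hK⟩ := Set.mem_iUnion.1 hp
    obtain ⟨a, b, _, h | h | h⟩ := (gasketV_iff K p).1 hK
    · exact ⟨(a, b), h⟩
    · exact ⟨(a + 1, b), h⟩
    · exact ⟨(a, b + 1), h⟩
  rcases x.2 with h | h
  · exact key _ h
  · obtain ⟨v, hv⟩ := key _ (Set.mem_neg.1 h)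
    refine ⟨(-v.1, -v.2), ?_⟩
    rw [← io_neg, ← hv, neg_neg]

/-- Lattice coordinates of a vertex. -/
noncomputable def co (x : SGV) : ℤ × ℤ := (exists_coord x).choose

lemma co_spec (x : SGV) : (x : ℝ × ℝ) = io (co x).1 (co x).2 := (exists_coord x).choose_spec

lemma co_inj : Function.Injective co := by
  intro x y h
  apply Subtype.ext
  rw [co_spec x, co_spec y, h]

lemma co_DV (x : SGV) : DV (co x).1 (co x).2 := by
  rw [← io_mem, ← co_spec]; exact x.2

lemma exists_of_DV {a b : ℤ} (h : DV a b) : ∃ x : SGV, co x = (a, b) := by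
  refine ⟨⟨io a b, (io_mem a b).2 h⟩, ?_⟩
  have := co_spec ⟨io a b, (io_mem a b).2 h⟩
  obtain ⟨h1, h2⟩ := io_inj this
  exact (Prod.ext h1 h2).symm

lemma co_o : co oSG = (0, 0) := by
  have := co_spec oSG
  have e0 : io 0 0 = (0, 0) := by simp [io]
  have h : io 0 0 = io (co oSG).1 (co oSG).2 := by rw [← this, e0]; rfl
  obtain ⟨h1, h2⟩ := io_inj h
  exact (Prod.ext h1 h2).symm

/-- Oriented edges of the one-sided gasket. -/
def EE (a b c d : ℤ) : Prop :=
  (TT a b ∧ c = a + 1 ∧ d = b) ∨ (TT a b ∧ c = a ∧ d = b + 1) ∨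
    (TT (a - 1) b ∧ c = a - 1 ∧ d = b + 1)

lemma gasketE_union_iff (a b c d : ℤ) :
    (io a b, io c d) ∈ (⋃ n, gasketE n) ↔ EE a b c d := by
  simp only [Set.mem_iUnion, gasketE_iff]
  constructor
  · rintro ⟨K, c, d, ht, ⟨h, h'⟩ | ⟨h, h'⟩ | ⟨h, h'⟩⟩ <;> obtain ⟨rfl, rfl⟩ := io_inj h <;>
      obtain ⟨rfl, rfl⟩ := io_inj h'
    · exact Or.inl ⟨⟨K, ht⟩, rfl, rfl⟩
    · exact Or.inr (Or.inl ⟨⟨K, ht⟩, rfl, rfl⟩)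
    · exact Or.inr (Or.inr ⟨⟨K, by simpa using ht⟩, by ring, rfl⟩)
  · rintro (⟨⟨K, h⟩, rfl, rfl⟩ | ⟨⟨K, h⟩, rfl, rfl⟩ | ⟨⟨K, h⟩, rfl, rfl⟩)
    · exact ⟨K, _, _, h, Or.inl ⟨rfl, rfl⟩⟩
    · exact ⟨K, _, _, h, Or.inr (Or.inl ⟨rfl, rfl⟩)⟩
    · exact ⟨K, _, _, h, Or.inr (Or.inr ⟨by rw [sub_add_cancel], rfl⟩)⟩

lemma SGE_iff (a b c d : ℤ) :
    (io a b, io c d) ∈ SGE ↔ EE a b c d ∨ EE (-a) (-b) (-c) (-d) := by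
  unfold SGE
  rw [Set.mem_union, gasketE_union_iff, ← gasketE_union_iff (-a)]
  apply or_congr Iff.rfl
  constructor
  · rintro ⟨⟨p, q⟩, h, h'⟩
    simp only [Prod.mk.injEq] at h'
    rw [← io_neg, ← io_neg, ← h'.1, ← h'.2, neg_neg, neg_neg]
    exact h
  · intro h
    exact ⟨_, h, by simp [io_neg]⟩

/-- Adjacency in coordinates. -/
def AA (a b c d : ℤ) : Prop :=
  (c = a + 1 ∧ d = b ∧ (TT a b ∨ TT (-a - 1) (-b))) ∨
  (c = a ∧ d = b + 1 ∧ (TT a b ∨ TT (-a) (-b - 1))) ∨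
  (c = a - 1 ∧ d = b ∧ (TT (a - 1) b ∨ TT (-a) (-b))) ∨
  (c = a - 1 ∧ d = b + 1 ∧ (TT (a - 1) b ∨ TT (-a) (-b - 1))) ∨
  (c = a ∧ d = b - 1 ∧ (TT a (b - 1) ∨ TT (-a) (-b))) ∨
  (c = a + 1 ∧ d = b - 1 ∧ (TT a (b - 1) ∨ TT (-a - 1) (-b)))

lemma AA_of_EE {a b c d : ℤ} (h : EE a b c d) : AA a b c d ∧ AA c d a b ∧
    AA (-a) (-b) (-c) (-d) ∧ AA (-c) (-d) (-a) (-b) := by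
  unfold AA
  rcases h with ⟨h, rfl, rfl⟩ | ⟨h, rfl, rfl⟩ | ⟨h, rfl, rfl⟩
  · refine ⟨Or.inl ⟨rfl, rfl, Or.inl h⟩, 
      Or.inr (Or.inr (Or.inl ⟨by ring, rfl, Or.inl (by simpa using h)⟩)),
      Or.inr (Or.inr (Or.inl ⟨by ring, rfl, Or.inr (by simpa using h)⟩)),
      Or.inl ⟨by ring, rfl, Or.inr (by simpa using h)⟩⟩
  · refine ⟨Or.inr (Or.inl ⟨rfl, rfl, Or.inl h⟩), 
      Or.inr (Or.inr (Or.inr (Or.inr (Or.inl ⟨rfl, by ring, Or.inl (by simpa using h)⟩)))),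
      Or.inr (Or.inr (Or.inr (Or.inr (Or.inl ⟨rfl, by ring, Or.inr (by simpa using h)⟩)))),
      Or.inr (Or.inl ⟨rfl, by ring, Or.inr (by simpa using h)⟩)⟩
  · refine ⟨Or.inr (Or.inr (Or.inr (Or.inl ⟨rfl, rfl, Or.inl h⟩))), 
      Or.inr (Or.inr (Or.inr (Or.inr (Or.inr ⟨by ring, by ring, Or.inl (by simpa using h)⟩)))),
      Or.inr (Or.inr (Or.inr (Or.inr (Or.inr ⟨by ring, by ring, Or.inr (by simpa using h)⟩)))),
      Or.inr (Or.inr (Or.inr (Or.inl ⟨by ring, by ring, Or.inr (by simpa using h)⟩)))⟩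

lemma AA_imp {a b c d : ℤ} (h : AA a b c d) :
    EE a b c d ∨ EE (-a) (-b) (-c) (-d) ∨ EE c d a b ∨ EE (-c) (-d) (-a) (-b) := by
  unfold EE
  rcases h with ⟨rfl, rfl, h | h⟩ | ⟨rfl, rfl, h | h⟩ | ⟨rfl, rfl, h | h⟩ |
    ⟨rfl, rfl, h | h⟩ | ⟨rfl, rfl, h | h⟩ | ⟨rfl, rfl, h | h⟩
  · exact Or.inl (Or.inl ⟨h, rfl, rfl⟩)
  · refine Or.inr (Or.inr (Or.inr (Or.inl ⟨?_, by ring, rfl⟩)))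
    convert h using 1; ring
  · exact Or.inl (Or.inr (Or.inl ⟨h, rfl, rfl⟩))
  · refine Or.inr (Or.inr (Or.inr (Or.inr (Or.inl ⟨?_, rfl, by ring⟩))))
    convert h using 1; ring
  · exact Or.inr (Or.inr (Or.inl (Or.inl ⟨h, by ring, rfl⟩)))
  · exact Or.inr (Or.inl (Or.inl ⟨h, by ring, rfl⟩))
  · exact Or.inl (Or.inr (Or.inr ⟨h, rfl, rfl⟩))
  · refine Or.inr (Or.inr (Or.inr (Or.inr (Or.inr ⟨?_, by ring, by ring⟩))))
    convert h using 1 <;> ring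
  · exact Or.inr (Or.inr (Or.inl (Or.inr (Or.inl ⟨h, rfl, by ring⟩))))
  · exact Or.inr (Or.inl (Or.inr (Or.inl ⟨h, rfl, by ring⟩)))
  · refine Or.inr (Or.inr (Or.inl (Or.inr (Or.inr ⟨?_, by ring, by ring⟩))))
    convert h using 1; ring
  · refine Or.inr (Or.inl (Or.inr (Or.inr ⟨?_, by ring, by ring⟩)))
    exact h

lemma adj_iff (x y : SGV) :
    SGGraph.Adj x y ↔ AA (co x).1 (co x).2 (co y).1 (co y).2 := by
  unfold SGGraph
  rw [SimpleGraph.fromRel_adj, co_spec x, co_spec y, SGE_iff, SGE_iff]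
  constructor
  · rintro ⟨_, (h | h) | (h | h)⟩
    · exact (AA_of_EE h).1
    · simpa using (AA_of_EE h).2.2.1
    · exact (AA_of_EE h).2.1
    · simpa using (AA_of_EE h).2.2.2
  · intro h
    refine ⟨?_, ?_⟩
    · rintro rfl
      unfold AA at h
      omega
    · rcases AA_imp h with h | h | h | h
      · exact Or.inl (Or.inl h)
      · exact Or.inl (Or.inr h)
      · exact Or.inr (Or.inl h)
      · exact Or.inr (Or.inr h)

lemma AA_DV {a b c d : ℤ} (h : AA a b c d) : DV c d := by
  have key : ∀ {a b c d : ℤ}, EE a b c d → CV a b ∧ CV c d := by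
    intro a b c d h
    unfold CV
    rcases h with ⟨h, rfl, rfl⟩ | ⟨h, rfl, rfl⟩ | ⟨h, rfl, rfl⟩
    · exact ⟨Or.inl h, Or.inr (Or.inl (by simpa using h))⟩
    · exact ⟨Or.inl h, Or.inr (Or.inr (by simpa using h))⟩
    · exact ⟨Or.inr (Or.inl h), Or.inr (Or.inr (by simpa using h))⟩
  unfold DV
  rcases AA_imp h with h | h | h | h
  · exact Or.inl (key h).2
  · exact Or.inr (key h).2
  · exact Or.inl (key h).1
  · exact Or.inr (key h).1

/-- Sum over neighbours in the one-sided gasket. -/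
noncomputable def PS (K : ℕ) (h : ℤ → ℤ → ℝ) (a b : ℤ) : ℝ :=
  chi K a b * (h (a + 1) b + h a (b + 1)) +
  chi K (a - 1) b * (h (a - 1) b + h (a - 1) (b + 1)) +
  chi K a (b - 1) * (h a (b - 1) + h (a + 1) (b - 1))

lemma ite_or_chi {K : ℕ} {a b c d : ℤ} (h1 : a + b < 2 ^ K) (h2 : c + d < 2 ^ K)
    (hne : a + c < 0 ∨ b + d < 0) (r : ℝ) :
    (if TT a b ∨ TT c d then r else 0) = (chi K a b + chi K c d) * r := by
  rw [TT_iff h1, TT_iff h2]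
  unfold chi
  by_cases e1 : T K a b <;> by_cases e2 : T K c d <;> simp [e1, e2]
  have := T_region e1
  have := T_region e2
  omega

lemma nbr_sum [SGGraph.LocallyFinite] (K : ℕ) (h : ℤ → ℤ → ℝ) (x : SGV)
    (hx : |(co x).1| + |(co x).2| < 2 ^ K) :
    ∑ y ∈ SGGraph.neighborFinset x, h (co y).1 (co y).2 =
      PS K h (co x).1 (co x).2 + PS K (fun a b => h (-a) (-b)) (-(co x).1) (-(co x).2) := by
  have himg : (SGGraph.neighborFinset x).image co =
      ({((co x).1 + 1, (co x).2), ((co x).1, (co x).2 + 1), ((co x).1 - 1, (co x).2),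
        ((co x).1 - 1, (co x).2 + 1), ((co x).1, (co x).2 - 1),
        ((co x).1 + 1, (co x).2 - 1)} : Finset (ℤ × ℤ)).filter
        (fun v => AA (co x).1 (co x).2 v.1 v.2) := by
    ext ⟨c, d⟩
    simp only [Finset.mem_image, SimpleGraph.mem_neighborFinset, Finset.mem_filter,
      Finset.mem_insert, Finset.mem_singleton, Prod.mk.injEq]
    constructor
    · rintro ⟨y, hy, hyc⟩
      rw [adj_iff, hyc] at hy
      refine ⟨?_, hy⟩
      unfold AA at hy
      omega
    · rintro ⟨_, hA⟩
      obtain ⟨y, hy⟩ := exists_of_DV (AA_DV hA)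
      exact ⟨y, by rw [adj_iff, hy]; exact hA, hy⟩
  have hs : ∑ y ∈ SGGraph.neighborFinset x, h (co y).1 (co y).2 =
      ∑ v ∈ (SGGraph.neighborFinset x).image co, h v.1 v.2 := by
    rw [Finset.sum_image (fun _ _ _ _ h => co_inj h)]
  rw [hs, himg, Finset.sum_filter]
  generalize (co x).1 = a at *
  generalize (co x).2 = b at *
  have ha1 := le_abs_self a
  have ha2 := neg_le_abs a
  have hb1 := le_abs_self b
  have hb2 := neg_le_abs b
  rw [Finset.sum_insert (by simp only [Finset.mem_insert, Finset.mem_singleton, Prod.mk.injEq]; omega), Finset.sum_insert (by simp only [Finset.mem_insert, Finset.mem_singleton, Prod.mk.injEq]; omega),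
    Finset.sum_insert (by simp only [Finset.mem_insert, Finset.mem_singleton, Prod.mk.injEq]; omega), Finset.sum_insert (by simp only [Finset.mem_insert, Finset.mem_singleton, Prod.mk.injEq]; omega),
    Finset.sum_insert (by simp only [Finset.mem_insert, Finset.mem_singleton, Prod.mk.injEq]; omega), Finset.sum_singleton]
  have c1 : AA a b (a + 1) b ↔ (TT a b ∨ TT (-a - 1) (-b)) := by
    unfold AA
    exact ⟨fun h => by rcases h with h | h | h | h | h | h <;> first | exact h.2.2 | omega,
      fun h => Or.inl ⟨rfl, rfl, h⟩⟩
  have c2 : AA a b a (b + 1) ↔ (TT a b ∨ TT (-a) (-b - 1)) := by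
    unfold AA
    exact ⟨fun h => by rcases h with h | h | h | h | h | h <;> first | omega | exact h.2.2,
      fun h => Or.inr (Or.inl ⟨rfl, rfl, h⟩)⟩
  have c3 : AA a b (a - 1) b ↔ (TT (a - 1) b ∨ TT (-a) (-b)) := by
    unfold AA
    exact ⟨fun h => by rcases h with h | h | h | h | h | h <;> first | omega | exact h.2.2,
      fun h => Or.inr (Or.inr (Or.inl ⟨rfl, rfl, h⟩))⟩
  have c4 : AA a b (a - 1) (b + 1) ↔ (TT (a - 1) b ∨ TT (-a) (-b - 1)) := by
    unfold AA
    exact ⟨fun h => by rcases h with h | h | h | h | h | h <;> first | omega | exact h.2.2,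
      fun h => Or.inr (Or.inr (Or.inr (Or.inl ⟨rfl, rfl, h⟩)))⟩
  have c5 : AA a b a (b - 1) ↔ (TT a (b - 1) ∨ TT (-a) (-b)) := by
    unfold AA
    exact ⟨fun h => by rcases h with h | h | h | h | h | h <;> first | omega | exact h.2.2,
      fun h => Or.inr (Or.inr (Or.inr (Or.inr (Or.inl ⟨rfl, rfl, h⟩))))⟩
  have c6 : AA a b (a + 1) (b - 1) ↔ (TT a (b - 1) ∨ TT (-a - 1) (-b)) := by
    unfold AA
    exact ⟨fun h => by rcases h with h | h | h | h | h | h <;> first | omega | exact h.2.2,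
      fun h => Or.inr (Or.inr (Or.inr (Or.inr (Or.inr ⟨rfl, rfl, h⟩))))⟩
  simp only [c1, c2, c3, c4, c5, c6]
  rw [ite_or_chi (K := K) (by omega) (by omega) (by omega),
    ite_or_chi (K := K) (by omega) (by omega) (by omega),
    ite_or_chi (K := K) (by omega) (by omega) (by omega),
    ite_or_chi (K := K) (by omega) (by omega) (by omega),
    ite_or_chi (K := K) (by omega) (by omega) (by omega),
    ite_or_chi (K := K) (by omega) (by omega) (by omega)]
  unfold PS
  simp only [neg_neg, show -(-a + 1) = a - 1 by ring, show -(-b + 1) = b - 1 by ring,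
    show -(-a - 1) = a + 1 by ring, show -(-b - 1) = b + 1 by ring]
  ring

lemma exists_pow (m : ℤ) : ∃ K : ℕ, m < 2 ^ K := by
  refine ⟨m.toNat, ?_⟩
  have h : m.toNat < 2 ^ m.toNat := Nat.lt_two_pow_self
  have h2 : ((2 ^ m.toNat : ℕ) : ℤ) = 2 ^ m.toNat := by push_cast; ring
  omega

lemma degree_four [SGGraph.LocallyFinite] (x : SGV) : SGGraph.degree x = 4 := by
  obtain ⟨K, hK⟩ := exists_pow (|(co x).1| + |(co x).2|)
  have h := nbr_sum K (fun _ _ => 1) x hK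
  have h2 := Mm_two hK
  rw [if_pos (co_DV x)] at h2
  have h3 : (SGGraph.degree x : ℝ) = 4 := by
    rw [← SimpleGraph.card_neighborFinset_eq_degree]
    simp only [Finset.sum_const, nsmul_eq_mul, mul_one] at h
    rw [h]
    unfold PS
    unfold Mm at h2
    linarith
  exact_mod_cast h3

/-- Height of a vertex. -/
noncomputable def lev (x : SGV) : ℕ := (|(co x).1| + |(co x).2|).toNat

lemma lev_cast (x : SGV) : (lev x : ℤ) = |(co x).1| + |(co x).2| := by
  unfold lev
  rw [Int.toNat_of_nonneg (by positivity)]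

lemma lev_adj {x y : SGV} (h : SGGraph.Adj x y) : lev y ≤ lev x + 1 := by
  have hx := lev_cast x
  have hy := lev_cast y
  rw [adj_iff] at h
  have key : ∀ {a b c d : ℤ}, EE a b c d → |c| + |d| ≤ |a| + |b| + 1 ∧
      |a| + |b| ≤ |c| + |d| + 1 := by
    intro a b c d h
    rcases h with ⟨h, rfl, rfl⟩ | ⟨h, rfl, rfl⟩ | ⟨h, rfl, rfl⟩ <;> have := TT_nonneg h <;>
      constructor <;> simp only [abs] <;> grind
  rcases AA_imp h with h | h | h | h <;> have := key h <;>
    try simp only [abs_neg] at this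
  all_goals omega

lemma lev_le_walk {x y : SGV} (p : SGGraph.Walk x y) : lev y ≤ lev x + p.length := by
  induction p with
  | nil => simp
  | cons h p ih =>
    have := lev_adj h
    rw [SimpleGraph.Walk.length_cons]; omega

lemma exists_lower (x : SGV) (hx : 0 < lev x) : ∃ y, SGGraph.Adj x y ∧ lev y + 1 = lev x := by
  obtain ⟨K, hK⟩ := exists_pow (|(co x).1| + |(co x).2|)
  have hl := lev_cast x
  have hd := co_DV x
  have key : ∀ a b : ℤ, |a| + |b| < 2 ^ K → 0 < |a| + |b| → CV a b →
      (TT (a - 1) b ∨ TT a (b - 1)) := by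
    intro a b hab hpos hc
    have hn := CV_nonneg hc
    rw [abs_of_nonneg hn.1, abs_of_nonneg hn.2] at hab hpos
    rw [CV_iff hab] at hc
    have hcor : ¬ Cor K a b := by unfold Cor; omega
    rcases Mm_cases K a b with h | h | h
    · exact absurd h.1 hc
    · by_contra hne
      push Not at hne
      have h1 : chi K (a - 1) b = 0 := by
        by_contra h'; exact hne.1 ⟨K, chi_ne h'⟩
      have h2 : chi K a (b - 1) = 0 := by
        by_contra h'; exact hne.2 ⟨K, chi_ne h'⟩
      have h3 := h.1
      unfold Mm at h3
      rw [h1, h2] at h3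
      unfold chi at h3
      split_ifs at h3 <;> norm_num at h3
    · exact absurd h.2 hcor
  have fin : ∀ c d : ℤ, AA (co x).1 (co x).2 c d → |c| + |d| + 1 = lev x →
      ∃ y, SGGraph.Adj x y ∧ lev y + 1 = lev x := by
    intro c d hA hcd
    obtain ⟨y, hy⟩ := exists_of_DV (AA_DV hA)
    refine ⟨y, by rw [adj_iff, hy]; exact hA, ?_⟩
    have := lev_cast y
    rw [hy] at this
    simp only at this
    omega
  generalize (co x).1 = a at *
  generalize (co x).2 = b at *
  rcases hd with hd | hd
  · rcases key a b hK (by omega) hd with h | h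
    · have := TT_nonneg h
      apply fin (a - 1) b (Or.inr (Or.inr (Or.inl ⟨rfl, rfl, Or.inl h⟩)))
      rw [hl, abs_of_nonneg this.1, abs_of_nonneg (by omega : 0 ≤ a)]; ring
    · have := TT_nonneg h
      apply fin a (b - 1) (Or.inr (Or.inr (Or.inr (Or.inr (Or.inl ⟨rfl, rfl, Or.inl h⟩)))))
      rw [hl, abs_of_nonneg this.2, abs_of_nonneg (by omega : 0 ≤ b)]; ring
  · rcases key (-a) (-b) (by simpa using hK) (by simp only [abs_neg]; omega) hd with h | h
    · have := TT_nonneg h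
      apply fin (a + 1) b (Or.inl ⟨rfl, rfl, Or.inr h⟩)
      rw [hl, abs_of_nonpos (by omega : a + 1 ≤ 0), abs_of_nonpos (by omega : a ≤ 0)]; ring
    · have := TT_nonneg h
      apply fin a (b + 1) (Or.inr (Or.inl ⟨rfl, rfl, Or.inr h⟩))
      rw [hl, abs_of_nonpos (by omega : b + 1 ≤ 0), abs_of_nonpos (by omega : b ≤ 0)]; ring

lemma lev_o : lev oSG = 0 := by
  unfold lev; rw [co_o]; simp

lemma lev_zero {x : SGV} (h : lev x = 0) : x = oSG := by
  have hl := lev_cast x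
  rw [h] at hl
  apply co_inj
  rw [co_o]
  have h1 := abs_nonneg (co x).1
  have h2 := abs_nonneg (co x).2
  have h3 : |(co x).1| = 0 := by push_cast at hl; omega
  have h4 : |(co x).2| = 0 := by push_cast at hl; omega
  exact Prod.ext (abs_eq_zero.1 h3) (abs_eq_zero.1 h4)

lemma exists_walk (m : ℕ) (x : SGV) (hx : lev x = m) :
    ∃ p : SGGraph.Walk x oSG, p.length = m := by
  induction m generalizing x with
  | zero =>
    have := lev_zero hx
    subst this
    exact ⟨SimpleGraph.Walk.nil, rfl⟩
  | succ m ih =>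
    obtain ⟨y, hy, hl⟩ := exists_lower x (by omega)
    obtain ⟨p, hp⟩ := ih y (by omega)
    exact ⟨SimpleGraph.Walk.cons hy p, by simp [hp]⟩

lemma dist_eq (x : SGV) : SGGraph.dist oSG x = lev x := by
  obtain ⟨p, hp⟩ := exists_walk (lev x) x rfl
  apply le_antisymm
  · have := SimpleGraph.dist_le p.reverse
    rwa [SimpleGraph.Walk.length_reverse, hp] at this
  · have hr : SGGraph.Reachable oSG x := ⟨p.reverse⟩
    obtain ⟨q, hq⟩ := hr.exists_walk_length_eq_dist
    have := lev_le_walk q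
    rw [lev_o] at this
    omega

end Interface

section Final

lemma PS_eq (K : ℕ) (h : ℤ → ℤ → ℝ) (a b : ℤ) :
    PS K h a b = Lam K h a b + 2 * Mm K a b * h a b := by
  unfold PS Lam Mm; ring

/-- Extension of a function of nonnegative coordinates to the whole gasket. -/
noncomputable def ext (f : ℤ → ℤ → ℝ) (x : SGV) : ℝ := f |(co x).1| |(co x).2|

lemma lap_ext [SGGraph.LocallyFinite] (K : ℕ) (f : ℤ → ℤ → ℝ) (x : SGV)
    (hx : |(co x).1| + |(co x).2| < 2 ^ K) :
    ∑ y ∈ SGGraph.neighborFinset x, ext f y - 4 * ext f x =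
      Lam K f (co x).1 (co x).2 + Lam K f (-(co x).1) (-(co x).2) := by
  have h := nbr_sum K (fun a b => f |a| |b|) x hx
  have h2 := Mm_two hx
  rw [if_pos (co_DV x)] at h2
  have e1 : ∀ a b, Lam K (fun a b => f |a| |b|) a b = Lam K f a b := by
    apply Lam_congr
    intro x y h1 h2 _
    rw [abs_of_nonneg h1, abs_of_nonneg h2]
  simp only [abs_neg] at h
  unfold ext
  rw [h, PS_eq, PS_eq, e1, e1]
  simp only [abs_neg]
  linear_combination 2 * f |(co x).1| |(co x).2| * h2

lemma stepOp_eq [SGGraph.LocallyFinite] (B : Finset SGV) (w : SGV → ℝ) (hw : ∀ x, x ∉ B → w x = 0)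
    (x : SGV) : stepOp SGGraph B w x = 4⁻¹ * ∑ y ∈ SGGraph.neighborFinset x, w y := by
  unfold stepOp
  congr 1
  apply Finset.sum_congr rfl
  intro y _
  split_ifs with h
  · rfl
  · rw [hw y h]

lemma stepOp_le [SGGraph.LocallyFinite] (B : Finset SGV) (w : SGV → ℝ) (hw : ∀ x, 0 ≤ w x)
    (x : SGV) : stepOp SGGraph B w x ≤ 4⁻¹ * ∑ y ∈ SGGraph.neighborFinset x, w y := by
  unfold stepOp
  apply mul_le_mul_of_nonneg_left _ (by norm_num)
  apply Finset.sum_le_sum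
  intro y _
  split_ifs with h
  · rfl
  · exact hw y

lemma card_ball (K n : ℕ) (hn : n + 1 ≤ 2 ^ K) (B : Finset SGV)
    (hB : ∀ x, x ∈ B ↔ lev x < n + 1) : (B.card : ℝ) = Nn K (n + 1) + 2 * Nn K n := by
  have h1 := hasSum_DV K n hn
  have hmem : ∀ v : ℤ × ℤ, (|v.1| + |v.2| < ((n + 1 : ℕ) : ℤ) ∧ DV v.1 v.2) ↔ v ∈ B.image co := by
    intro v
    rw [Finset.mem_image]
    constructor
    · rintro ⟨h, hd⟩
      obtain ⟨x, hx⟩ := exists_of_DV hd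
      refine ⟨x, ?_, hx⟩
      rw [hB]
      have := lev_cast x
      rw [hx] at this
      simp only at this
      omega
    · rintro ⟨x, hx, rfl⟩
      refine ⟨?_, co_DV x⟩
      rw [← lev_cast]
      exact_mod_cast (hB x).1 hx
  have h2 : HasSum (fun v : ℤ × ℤ =>
      if |v.1| + |v.2| < ((n + 1 : ℕ) : ℤ) ∧ DV v.1 v.2 then (1 : ℝ) else 0)
      (∑ v ∈ B.image co, if |v.1| + |v.2| < ((n + 1 : ℕ) : ℤ) ∧ DV v.1 v.2 then (1 : ℝ) else 0) := by
    apply hasSum_sum_of_ne_finset_zero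
    intro v hv
    rw [if_neg (fun h => hv ((hmem v).1 h))]
  rw [h1.unique h2, Finset.sum_congr rfl (fun v hv => if_pos ((hmem v).2 hv)), Finset.sum_const,
    Finset.card_image_of_injective _ co_inj]
  simp

lemma DV_Mm {K : ℕ} {a b : ℤ} (h : DV a b) (hab : |a| + |b| < 2 ^ K) : Mm K |a| |b| ≠ 0 := by
  rcases h with h | h
  · have := CV_nonneg h
    rw [abs_of_nonneg this.1, abs_of_nonneg this.2] at *
    exact (CV_iff hab).1 h
  · have := CV_nonneg h
    rw [abs_of_nonpos (by omega : a ≤ 0), abs_of_nonpos (by omega : b ≤ 0)] at *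
    exact (CV_iff hab).1 h

lemma key_bound [SGGraph.LocallyFinite] (K n : ℕ) (hn : n + 1 ≤ 2 ^ K) (B : Finset SGV)
    (hB : ∀ x, x ∈ B ↔ lev x < n + 1) (z : SGV) (hz : z ∈ B) :
    ∑ y ∈ B, green SGGraph (B : Set SGV) y z ≤ 5 ^ K + 5 ^ K / 2 ∧
    ext (W K (n + 1)) z = 3 * Nn K (n + 1) * green SGGraph (B : Set SGV) oSG z -
      ∑ y ∈ B, green SGGraph (B : Set SGV) y z := by
  have hc : ((2 ^ K : ℕ) : ℤ) = 2 ^ K := by push_cast; ring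
  have hlev : ∀ y ∈ B, |(co y).1| + |(co y).2| < ((n + 1 : ℕ) : ℤ) := by
    intro y hy
    rw [← lev_cast]; exact_mod_cast (hB y).1 hy
  have h5 : (0 : ℝ) < 5 ^ K := by positivity
  have hFb := H_bounds K (5 ^ K) 0 0 (5 ^ K) h5.le le_rfl le_rfl le_rfl h5.le h5.le
  have h35 : ((3 : ℝ) / 5) ^ K * 5 ^ K = 3 ^ K := by
    rw [← mul_pow]; norm_num
  obtain ⟨hs, hS⟩ := green_summable SGGraph degree_four B z hz (ext (H (-1) K (5 ^ K) 0 0))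
    (fun y _ => (hFb _ _).1) (by
      intro y hy
      have hl := hlev y hy
      have ha1 := abs_nonneg (co y).1
      have hb1 := abs_nonneg (co y).2
      have ha2 := le_abs_self (co y).1
      have hb2 := le_abs_self (co y).2
      have ha3 := neg_le_abs (co y).1
      have hb3 := neg_le_abs (co y).2
      have hlap := lap_ext K (H (-1) K (5 ^ K) 0 0) y (by omega)
      have hst := stepOp_le B (ext (H (-1) K (5 ^ K) 0 0)) (fun y => (hFb _ _).1) y
      have hM := Mm_two (K := K) (a := (co y).1) (b := (co y).2) (by omega)
      rw [if_pos (co_DV y)] at hM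
      have hd : ∀ a b : ℤ, a + b < 2 ^ K → dl a b (2 ^ K) 0 = 0 ∧ dl a b 0 (2 ^ K) = 0 := by
        intro a b hab
        unfold dl
        exact ⟨if_neg (by omega), if_neg (by omega)⟩
      have d1 := hd (co y).1 (co y).2 (by omega)
      have d2 := hd (-(co y).1) (-(co y).2) (by omega)
      rw [Lam_H, Lam_H, d1.1, d1.2, d2.1, d2.2] at hlap
      have e0 : ((3 : ℝ) / 5) ^ K * (0 + 0 - 2 * 5 ^ K) - 2 * 3 ^ K * (-1) = 0 := by
        linear_combination (-2) * h35
      rw [e0] at hlap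
      linarith)
  refine ⟨hS.trans (hFb _ _).2, ?_⟩
  have hw0 : ∀ x, x ∉ B → ext (W K (n + 1)) x = 0 := by
    intro x hx
    apply W_zero K (n + 1) hn _ _ (abs_nonneg _) (abs_nonneg _)
    rw [hB, not_lt] at hx
    rw [← lev_cast]; exact_mod_cast hx
  have ho : oSG ∈ B := by rw [hB, lev_o]; omega
  rw [green_repr SGGraph degree_four B z hz hs (ext (W K (n + 1)))]
  have hterm : ∀ y ∈ B, (ext (W K (n + 1)) y - stepOp SGGraph B (ext (W K (n + 1))) y) *
      green SGGraph (B : Set SGV) y z =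
      (if y = oSG then 3 * Nn K (n + 1) * green SGGraph (B : Set SGV) y z else 0) -
        green SGGraph (B : Set SGV) y z := by
    intro y hy
    have hl := hlev y hy
    have ha1 := abs_nonneg (co y).1
    have hb1 := abs_nonneg (co y).2
    have ha2 := le_abs_self (co y).1
    have hb2 := le_abs_self (co y).2
    have ha3 := neg_le_abs (co y).1
    have hb3 := neg_le_abs (co y).2
    have hlap := lap_ext K (W K (n + 1)) y (by omega)
    have hM := Mm_two (K := K) (a := (co y).1) (b := (co y).2) (by omega)
    rw [if_pos (co_DV y)] at hM
    rw [Lam_W K (n + 1) hn _ _ (by omega), Lam_W K (n + 1) hn _ _ (by omega)] at hlap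
    rw [stepOp_eq B _ hw0]
    split_ifs with hyo
    · subst hyo
      rw [co_o] at hlap hM
      have : dl 0 0 0 0 = 1 := by simp [dl]
      simp only [neg_zero, this] at hlap hM
      linear_combination (- green SGGraph (B : Set SGV) oSG z / 4) * hlap
        - (green SGGraph (B : Set SGV) oSG z / 2) * hM
    · have h0 : ¬ ((co y).1 = 0 ∧ (co y).2 = 0) := by
        intro h
        apply hyo
        apply co_inj
        rw [co_o]
        exact Prod.ext h.1 h.2
      have e1 : dl (co y).1 (co y).2 0 0 = 0 := if_neg h0
      have e2 : dl (-(co y).1) (-(co y).2) 0 0 = 0 := if_neg (by omega)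
      rw [e1, e2] at hlap
      linear_combination (- green SGGraph (B : Set SGV) y z / 4) * hlap
        - (green SGGraph (B : Set SGV) y z / 2) * hM
  rw [Finset.sum_congr rfl hterm, Finset.sum_sub_distrib, Finset.sum_ite_eq' , if_pos ho]

lemma green_nonneg' [SGGraph.LocallyFinite] (B : Set SGV) (y z : SGV) :
    0 ≤ green SGGraph B y z := by
  rw [green_eq]
  exact tsum_nonneg (fun N => pw_nonneg _ _ _ _ _)

lemma main_ineq [SGGraph.LocallyFinite] (K' J j n : ℕ) (hn1 : 2 ^ K' < n + 1)
    (hn2 : n + 1 ≤ 2 ^ (K' + 1)) (hj : K' = j + J)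
    (hbig : (3 : ℝ) * 2 ^ (K' + 1) * 5 ^ (J + 1) ≤ 2 * 3 ^ K') (B : Finset SGV)
    (hB : ∀ x, x ∈ B ↔ lev x < n + 1) (z : SGV) (hz : lev z + 3 * 2 ^ j ≤ n + 1) :
    ∑ y ∈ B, green SGGraph (B : Set SGV) y z ≤ (B.card : ℝ) *
      green SGGraph (B : Set SGV) oSG z := by
  have hpos : 0 < 2 ^ j := by positivity
  have hzB : z ∈ B := by rw [hB]; omega
  obtain ⟨hS, hw⟩ := key_bound (K' + 1) n hn2 B hB z hzB
  have hS0 : 0 ≤ ∑ y ∈ B, green SGGraph (B : Set SGV) y z :=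
    Finset.sum_nonneg (fun y _ => green_nonneg' _ _ _)
  have hcard := card_ball (K' + 1) n hn2 B hB
  have hc : ((2 ^ (K' + 1) : ℕ) : ℤ) = 2 ^ (K' + 1) := by push_cast; ring
  have hcj : ((2 ^ j : ℕ) : ℤ) = 2 ^ j := by push_cast; ring
  have hl := lev_cast z
  have hwl : 2 * 5 ^ j ≤ ext (W (K' + 1) (n + 1)) z := by
    apply W_lower (K' + 1) (n + 1) j hn2 _ _ (abs_nonneg _) (abs_nonneg _)
    · omega
    · exact DV_Mm (co_DV z) (by omega)
    · omega
  have hd := Nn_diff (K' + 1) n hn2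
  have hN := Nn_lower K' (n + 1) hn1
  have hN0 := Nn_nonneg (K' + 1) n
  have h3 : (0 : ℝ) < 3 ^ K' := by positivity
  have h2 : (0 : ℝ) < 2 ^ (K' + 1) := by positivity
  have h5 : (0 : ℝ) < 5 ^ j := by positivity
  have e5 : (5 : ℝ) ^ (K' + 1) = 5 ^ j * 5 ^ (J + 1) := by
    rw [hj]; ring
  generalize hSd : ∑ y ∈ B, green SGGraph (B : Set SGV) y z = S at *
  generalize green SGGraph (B : Set SGV) oSG z = g at *
  generalize ext (W (K' + 1) (n + 1)) z = w at *
  rw [hcard]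
  generalize Nn (K' + 1) (n + 1) = N at *
  generalize Nn (K' + 1) n = M at *
  -- main estimate
  have a1 : 3 ^ K' * (2 * 5 ^ j) ≤ (N + 2 * M) * w :=
    mul_le_mul (by linarith) hwl (by positivity) (by linarith)
  have a2 : 2 * (N - M) * S ≤ 2 * 2 ^ (K' + 1) * (5 ^ (K' + 1) + 5 ^ (K' + 1) / 2) :=
    mul_le_mul (by linarith) hS hS0 (by positivity)
  have a3 : 2 * 2 ^ (K' + 1) * ((5 : ℝ) ^ (K' + 1) + 5 ^ (K' + 1) / 2) ≤ 3 ^ K' * (2 * 5 ^ j) := by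
    rw [e5]
    have := mul_le_mul_of_nonneg_right hbig h5.le
    linarith
  have hNp : 0 < N := by linarith
  have a4 : 0 ≤ 3 * N * ((N + 2 * M) * g - S) := by
    have : 3 * N * ((N + 2 * M) * g - S) = (N + 2 * M) * w - 2 * (N - M) * S := by
      rw [hw]; ring
    rw [this]; linarith
  have a5 := nonneg_of_mul_nonneg_right a4 (by linarith)
  linarith

lemma exists_K0 (J : ℕ) : ∃ K0 : ℕ, ∀ K', K0 ≤ K' →
    (3 : ℝ) * 2 ^ (K' + 1) * 5 ^ (J + 1) ≤ 2 * 3 ^ K' := by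
  obtain ⟨K0, h⟩ := pow_unbounded_of_one_lt ((3 : ℝ) * 5 ^ (J + 1)) (by norm_num : (1 : ℝ) < 3 / 2)
  refine ⟨K0, fun K' hK => ?_⟩
  have h1 : ((3 : ℝ) / 2) ^ K0 ≤ (3 / 2) ^ K' := pow_le_pow_right₀ (by norm_num) hK
  have h2 : ((3 : ℝ) / 2) ^ K' * 2 ^ K' = 3 ^ K' := by rw [← mul_pow]; norm_num
  have h3 : (0 : ℝ) < 2 ^ K' := by positivity
  have h4 : (3 : ℝ) * 5 ^ (J + 1) ≤ (3 / 2) ^ K' := by linarith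
  have h5 := mul_le_mul_of_nonneg_right h4 h3.le
  rw [h2] at h5
  rw [pow_succ]
  linarith

lemma exists_block (n : ℕ) (hn : 1 ≤ n) : ∃ K' : ℕ, 2 ^ K' < n + 1 ∧ n + 1 ≤ 2 ^ (K' + 1) := by
  refine ⟨Nat.log 2 n, ?_, ?_⟩
  · have := Nat.pow_log_le_self 2 (x := n) (by omega)
    omega
  · have := Nat.lt_pow_succ_log_self (b := 2) (by norm_num) n
    omega

end Final

/-- Mean value inequality for the stopped Green function on the Sierpinski gasket graph:
for every `ε > 0` there is `n_ε` such that for all `n ≥ n_ε` and all `z ∈ B_o(n(1-ε))`,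
`Σ_{y ∈ B_o(n)} g_n(y,z) ≤ |B_o(n)| · g_n(o,z)`. -/
theorem mean_value_green [SGGraph.LocallyFinite]
    (hfin : ∀ n : ℕ, ({y : SGV | SGGraph.dist oSG y < n} : Set SGV).Finite) :
    ∀ ε : ℝ, 0 < ε → ∃ nε : ℕ, ∀ n : ℕ, nε ≤ n → ∀ z : SGV,
      (SGGraph.dist oSG z : ℝ) < (n : ℝ) * (1 - ε) →
      ∑ y ∈ (hfin n).toFinset, green SGGraph {y : SGV | SGGraph.dist oSG y < n} y z ≤
        (({y : SGV | SGGraph.dist oSG y < n} : Set SGV).ncard : ℝ) *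
          green SGGraph {y : SGV | SGGraph.dist oSG y < n} oSG z := by
  intro ε hε
  obtain ⟨J, hJ⟩ := exists_pow_lt_of_lt_one hε (by norm_num : (1 / 2 : ℝ) < 1)
  obtain ⟨K0, hK0⟩ := exists_K0 (J + 2)
  refine ⟨2 ^ (K0 + J + 2 + 1), ?_⟩
  intro n hn z hz
  have hn2 : 2 ≤ n := le_trans (by
    calc 2 = 2 ^ 1 := rfl
      _ ≤ 2 ^ (K0 + J + 2 + 1) := Nat.pow_le_pow_right (by norm_num) (by omega)) hn
  obtain ⟨m, rfl⟩ : ∃ m, n = m + 1 := ⟨n - 1, by omega⟩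
  obtain ⟨K', hK1, hK2⟩ := exists_block m (by omega)
  have hKK : K0 + J + 2 ≤ K' := by
    have : 2 ^ (K0 + J + 2 + 1) ≤ 2 ^ (K' + 1) := hn.trans hK2
    have := (Nat.pow_le_pow_iff_right (by norm_num : 1 < 2)).1 this
    omega
  obtain ⟨j, hj⟩ : ∃ j, K' = j + (J + 2) := ⟨K' - (J + 2), by omega⟩
  rw [dist_eq] at hz
  have hB : ∀ x, x ∈ (hfin (m + 1)).toFinset ↔ lev x < m + 1 := by
    intro x
    rw [Set.Finite.mem_toFinset, Set.mem_ofPred_eq, dist_eq]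
  have hzl : lev z + 3 * 2 ^ j ≤ m + 1 := by
    have e1 : (2 : ℝ) ^ K' * (1 / 2) ^ J = 4 * 2 ^ j := by
      rw [hj, pow_add, pow_add]
      have : (2 : ℝ) ^ J * (1 / 2) ^ J = 1 := by rw [← mul_pow]; norm_num
      linear_combination 4 * 2 ^ j * this
    have e2 : (2 : ℝ) ^ K' ≤ ((m + 1 : ℕ) : ℝ) := by exact_mod_cast hK1.le
    have e3 : (2 : ℝ) ^ K' * (1 / 2) ^ J ≤ ((m + 1 : ℕ) : ℝ) * ε :=
      mul_le_mul e2 hJ.le (by positivity) (by positivity)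
    have e4 : (0 : ℝ) < 2 ^ j := by positivity
    have e5 : (lev z : ℝ) + 3 * 2 ^ j ≤ ((m + 1 : ℕ) : ℝ) := by linarith
    exact_mod_cast e5
  have h := main_ineq K' (J + 2) j m hK1 hK2 hj (hK0 K' (by omega)) (hfin (m + 1)).toFinset hB z hzl
  rw [Set.Finite.coe_toFinset] at h
  rw [Set.ncard_eq_toFinset_card _ (hfin (m + 1))]
  exact h

end IDLA
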